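/- arXiv:1408.0974 — 4 statements merged into one kernel-verified Lean document; each statement's English description precedes it below -/
import Mathlib

section
/- (Theorem 2.3, case (ii)) Assume hypotheses (H₀) with A = ∂Φ₂. If liminf_n λ_n β_n > 0, the sequence (λ_n) is bounded, and there exists K > 0 such that β_{n+1} − β_n ≤ K λ_{n+1} β_{n+1} for all n, then the sequence (x_n) converges weakly to a point of S as n → ∞, and lim_{n→∞} (Φ + Φ₂)(x_n) = min_{x ∈ C} (Φ + Φ₂)(x). -/
open Filter Topology
open scoped RealInnerProductSpace

variable {H : Type*} [NormedAddCommGroup H] [InnerProductSpace ℝ H] [CompleteSpace H]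

/-- A set-valued operator `A : H → Set H` is monotone. -/
def MonotoneOp (A : H → Set H) : Prop :=
  ∀ x y x' y', x' ∈ A x → y' ∈ A y → 0 ≤ ⟪x' - y', x - y⟫

/-- A set-valued operator is maximal monotone: it is monotone and its graph is not
properly contained in the graph of any other monotone operator. -/
def MaxMonotoneOp (A : H → Set H) : Prop :=
  MonotoneOp A ∧ ∀ B : H → Set H, MonotoneOp B → (∀ x, A x ⊆ B x) → B = A

/-- The (outward) normal cone to a set `C` at `x`: empty when `x ∉ C`. -/
def nCone (C : Set H) (x : H) : Set H :=
  {p | x ∈ C ∧ ∀ c ∈ C, ⟪p, c - x⟫ ≤ 0}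

/-- Subdifferential of an extended-real-valued function. -/
def ESubdiff (F : H → EReal) (x : H) : Set H :=
  {p | ∀ y, F x + ((⟪p, y - x⟫ : ℝ) : EReal) ≤ F y}

/-- Fenchel conjugate of an extended-real-valued function. -/
noncomputable def fenchelConj (F : H → EReal) (p : H) : EReal :=
  ⨆ y, (((⟪y, p⟫ : ℝ) : EReal) - F y)

/-- Support function of a set. -/
noncomputable def suppFun (C : Set H) (p : H) : EReal :=
  ⨆ c : C, ((⟪p, (c : H)⟫ : ℝ) : EReal)

/-- `F : H → EReal` is proper (not identically `+∞`, never `−∞`),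
lower-semicontinuous and convex. -/
def ProperLscConvexE (F : H → EReal) : Prop :=
  (∃ x, F x ≠ ⊤) ∧ (∀ x, F x ≠ ⊥) ∧ LowerSemicontinuous F ∧
    ∀ x y (t : ℝ), 0 ≤ t → t ≤ 1 →
      F (t • x + (1 - t) • y) ≤ ((t : ℝ) : EReal) * F x + (((1 - t : ℝ)) : EReal) * F y

/-- Weak convergence of a sequence in a Hilbert space. -/
def WeakConv (x : ℕ → H) (p : H) : Prop :=
  ∀ y : H, Tendsto (fun n => ⟪x n, y⟫) atTop (𝓝 ⟪p, y⟫)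

/-- A weak cluster point: weak limit of some subsequence. -/
def WeakClusterPt (x : ℕ → H) (p : H) : Prop :=
  ∃ φ : ℕ → ℕ, StrictMono φ ∧ WeakConv (x ∘ φ) p

/-- Boundedly inf-compact function: intersections of balls and sublevel sets are
relatively compact. -/
def BddInfCompact (F : H → EReal) : Prop :=
  ∀ R M : ℝ, 0 ≤ R → IsCompact (closure {p : H | ‖p‖ ≤ R ∧ F p ≤ (M : EReal)})

/-- The data of the (SFBP) algorithm together with hypotheses (H₀). -/
structure SFBP (H : Type*) [NormedAddCommGroup H] [InnerProductSpace ℝ H]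
    [CompleteSpace H] where
  /-- the maximal monotone operator -/
  A : H → Set H
  /-- the smooth potential -/
  Φ : H → ℝ
  /-- its gradient -/
  Φ' : H → H
  /-- the smooth penalization potential -/
  Ψ₁ : H → ℝ
  /-- its gradient -/
  Ψ₁' : H → H
  /-- the nonsmooth penalization potential -/
  Ψ₂ : H → EReal
  /-- the constraint set -/
  C : Set H
  /-- the step sizes -/
  lam : ℕ → ℝ
  /-- the penalization parameters -/
  beta : ℕ → ℝ
  /-- Lipschitz constant of ∇Φ -/
  LΦ : ℝ
  /-- Lipschitz constant of ∇Ψ₁ -/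
  LΨ₁ : ℝ
  /-- the sequence generated by the algorithm -/
  x : ℕ → H
  convΦ : ConvexOn ℝ Set.univ Φ
  gradΦ : ∀ p, HasGradientAt Φ (Φ' p) p
  lipΦ : ∀ p q, ‖Φ' p - Φ' q‖ ≤ LΦ * ‖p - q‖
  convΨ₁ : ConvexOn ℝ Set.univ Ψ₁
  gradΨ₁ : ∀ p, HasGradientAt Ψ₁ (Ψ₁' p) p
  lipΨ₁ : ∀ p q, ‖Ψ₁' p - Ψ₁' q‖ ≤ LΨ₁ * ‖p - q‖
  properΨ₂ : ProperLscConvexE Ψ₂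
  Ψ₁nonneg : ∀ p, 0 ≤ Ψ₁ p
  Ψ₂nonneg : ∀ p, (0 : EReal) ≤ Ψ₂ p
  minΨ₁ : ∃ p, Ψ₁ p = 0
  minΨ₂ : ∃ p, Ψ₂ p = 0
  Cdef : C = {p | ∀ q, Ψ₁ p ≤ Ψ₁ q} ∩ {p | ∀ q, Ψ₂ p ≤ Ψ₂ q}
  Cne : C.Nonempty
  maxmonA : MaxMonotoneOp A
  maxmonT : MaxMonotoneOp
    (fun p => {w | ∃ za ∈ A p, ∃ v ∈ nCone C p, w = za + Φ' p + v})
  Sne : ∃ p, ∃ za ∈ A p, ∃ v ∈ nCone C p, za + Φ' p + v = 0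
  lamPos : ∀ n, 0 < lam n
  betaPos : ∀ n, 0 < beta n
  lamDiv : Tendsto (fun N => ∑ k ∈ Finset.range N, lam k) atTop atTop
  sumSq : Summable fun n => LΦ * lam n ^ 2
  limsupCond : ∃ γ : ℝ, γ < 2 ∧ ∀ᶠ n in atTop, LΨ₁ * (lam n * beta n) ≤ γ
  keyCond : ∀ z : H, (∃ u, z ∈ nCone C u) →
    ∃ M : ℝ, ∀ N : ℕ, ∑ n ∈ Finset.range N,
      (((lam n * beta n : ℝ)) : EReal) *
        (fenchelConj (fun q => ((Ψ₁ q : ℝ) : EReal) + Ψ₂ q) ((beta n)⁻¹ • z)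
          - suppFun C ((beta n)⁻¹ • z)) ≤ (M : EReal)
  algo : ∀ n, ∃ a ∈ A (x (n + 1)), ∃ w ∈ ESubdiff Ψ₂ (x (n + 1)),
    x n - x (n + 1) = lam n • (Φ' (x n) + beta n • Ψ₁' (x n) + a + beta n • w)

/-- The solution set `S = (A + ∇Φ + N_C)⁻¹(0)`. -/
def SFBP.S (d : SFBP H) : Set H :=
  {p | ∃ za ∈ d.A p, ∃ v ∈ nCone d.C p, za + d.Φ' p + v = 0}

lemma aux_line_deriv (f : H → ℝ) (f' : H → H) (hg : ∀ p, HasGradientAt f (f' p) p) (x v : H)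
    (t : ℝ) : HasDerivAt (fun t : ℝ => f (x + t • v)) ⟪f' (x + t • v), v⟫ t := by
  have h1 : HasDerivAt (fun t : ℝ => x + t • v) v t := by
    simpa using ((hasDerivAt_id t).smul_const v).const_add x
  have h2 := (hg (x + t • v)).hasFDerivAt
  have h3 := h2.comp_hasDerivAt t h1
  have e : InnerProductSpace.toDual ℝ H (f' (x + t • v)) v = ⟪f' (x + t • v), v⟫ := by simp
  rw [e] at h3
  exact h3

lemma aux_grad_ineq (f : H → ℝ) (f' : H → H) (hc : ConvexOn ℝ Set.univ f)
    (hg : ∀ p, HasGradientAt f (f' p) p) (x y : H) : f x + ⟪f' x, y - x⟫ ≤ f y := by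
  have hd := aux_line_deriv f f' hg x (y - x) 0
  have hcv : ConvexOn ℝ Set.univ (fun t : ℝ => f (x + t • (y - x))) := by
    have := hc.comp_affineMap (AffineMap.lineMap x y : ℝ →ᵃ[ℝ] H)
    refine ⟨convex_univ, fun a _ b _ s t hs ht hst => ?_⟩
    have h := this.2 (Set.mem_univ a) (Set.mem_univ b) hs ht hst
    simpa [AffineMap.lineMap_apply, add_comm] using h
  have := hcv.le_slope_of_hasDerivAt (Set.mem_univ 0) (Set.mem_univ 1) one_pos hd
  simp [slope_def_field] at this
  linarith

lemma aux_descent (f : H → ℝ) (f' : H → H) (L : ℝ)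
    (hg : ∀ p, HasGradientAt f (f' p) p) (hl : ∀ p q, ‖f' p - f' q‖ ≤ L * ‖p - q‖) (x y : H) :
    f y ≤ f x + ⟪f' x, y - x⟫ + L / 2 * ‖y - x‖ ^ 2 := by
  set v := y - x with hv
  have hd := aux_line_deriv f f' hg x v
  have hB : ∀ t : ℝ, HasDerivAt (fun t : ℝ => f x + t * ⟪f' x, v⟫ + L / 2 * ‖v‖ ^ 2 * t ^ 2)
      (⟪f' x, v⟫ + L * t * ‖v‖ ^ 2) t := by
    intro t
    have h1 := ((hasDerivAt_id t).mul_const ⟪f' x, v⟫).const_add (f x)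
    have h2 := (hasDerivAt_pow 2 t).const_mul (L / 2 * ‖v‖ ^ 2)
    refine (h1.add h2).congr_deriv ?_
    simp
    ring
  have := image_le_of_deriv_right_le_deriv_boundary (a := 0) (b := 1)
    (fun t _ => (hd t).continuousAt.continuousWithinAt)
    (fun t _ => (hd t).hasDerivWithinAt) (B := fun t : ℝ => f x + t * ⟪f' x, v⟫ + L / 2 * ‖v‖ ^ 2 * t ^ 2)
    (by simp) (fun t _ => (hB t).continuousAt.continuousWithinAt)
    (fun t _ => (hB t).hasDerivWithinAt) (by
      intro t ht
      have h1 : ⟪f' (x + t • v) - f' x, v⟫ ≤ ‖f' (x + t • v) - f' x‖ * ‖v‖ := real_inner_le_norm _ _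
      have h2 := hl (x + t • v) x
      rw [add_sub_cancel_left, norm_smul, Real.norm_eq_abs, abs_of_nonneg ht.1] at h2
      rw [inner_sub_left] at h1
      have h3 := mul_le_mul_of_nonneg_right h2 (norm_nonneg v)
      nlinarith) (Set.right_mem_Icc.2 zero_le_one)
  simp at this
  rw [hv] at this ⊢
  simp at this
  linarith

lemma aux_cocoer (f : H → ℝ) (f' : H → H) (L : ℝ) (hL : 0 ≤ L) (hc : ConvexOn ℝ Set.univ f)
    (hg : ∀ p, HasGradientAt f (f' p) p) (hl : ∀ p q, ‖f' p - f' q‖ ≤ L * ‖p - q‖)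
    (h0 : ∀ p, 0 ≤ f p) (u : H) (hu : f u = 0) (x : H) :
    ‖f' x‖ ^ 2 ≤ L * ⟪f' x, x - u⟫ := by
  have hgu : f' u = 0 := by
    have hmin : IsLocalMin f u := Filter.Eventually.of_forall fun q => by rw [hu]; exact h0 q
    have := hmin.hasFDerivAt_eq_zero (hg u).hasFDerivAt
    simpa using this
  rcases hL.eq_or_lt with rfl | hL
  · have := hl x u
    rw [hgu] at this
    simp at this
    simp [this]
  have a1 := aux_descent f f' L hg hl u (u + L⁻¹ • f' x)
  have a2 := aux_grad_ineq f f' hc hg x (u + L⁻¹ • f' x)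
  have b1 := aux_descent f f' L hg hl x (x - L⁻¹ • f' x)
  have b2 := h0 (x - L⁻¹ • f' x)
  have e1 : u + L⁻¹ • f' x - x = L⁻¹ • f' x - (x - u) := by abel
  rw [e1, inner_sub_right, real_inner_smul_right, real_inner_self_eq_norm_sq] at a2
  rw [hgu, hu, add_sub_cancel_left, norm_smul, inner_zero_left] at a1
  have e2 : x - L⁻¹ • f' x - x = - (L⁻¹ • f' x) := by abel
  rw [e2, inner_neg_right, real_inner_smul_right, real_inner_self_eq_norm_sq, norm_neg,
    norm_smul] at b1
  rw [Real.norm_eq_abs, abs_of_pos (inv_pos.2 hL)] at a1 b1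
  have e3 : L / 2 * (L⁻¹ * ‖f' x‖) ^ 2 = L⁻¹ * ‖f' x‖ ^ 2 / 2 := by field_simp
  rw [e3] at a1 b1
  have : L⁻¹ * ‖f' x‖ ^ 2 ≤ ⟪f' x, x - u⟫ := by linarith
  calc ‖f' x‖ ^ 2 = L * (L⁻¹ * ‖f' x‖ ^ 2) := by field_simp
    _ ≤ _ := by gcongr

/-- Real-sequence lemma giving the limsup bound. -/
lemma aux_limsup (lam g : ℕ → ℝ) (K D : ℝ) (n0 : ℕ) (hK : 0 < K) (hlam : ∀ n, 0 < lam n)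
    (hdiv : Tendsto (fun N => ∑ k ∈ Finset.range N, lam k) atTop atTop)
    (hD : 0 ≤ D)
    (hg : ∀ n ≥ n0, -D ≤ g n) (hsum : Summable fun n => |lam n * g (n + 1)|)
    (hstep : ∀ n ≥ n0, K * lam n ≤ 1 / 2 → g (n + 1) ≤ g n + 2 * K * lam n * (g n + D))
    (δ : ℝ) (hδ : 0 < δ) : ∀ᶠ n in atTop, g n ≤ δ := by
  set s : ℕ → ℝ := fun N => ∑ k ∈ Finset.range N, lam k with hs
  have hs1 : ∀ n, s (n + 1) = s n + lam n := fun n => Finset.sum_range_succ _ _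
  have hmono : Monotone s := monotone_nat_of_le_succ fun n => by rw [hs1]; linarith [hlam n]
  -- window length
  obtain ⟨τ, hτ0, hτK, hτ⟩ : ∃ τ > 0, K * τ ≤ 1 / 2 ∧ Real.exp (2 * K * τ) * (D + δ / 2) < D + δ := by
    have hc : Tendsto (fun τ : ℝ => Real.exp (2 * K * τ) * (D + δ / 2)) (𝓝[>] 0)
        (𝓝 (Real.exp (2 * K * 0) * (D + δ / 2))) := by
      apply tendsto_nhdsWithin_of_tendsto_nhds
      exact (Continuous.tendsto (by fun_prop) 0)
    have h1 := hc.eventually_lt_const (u := D + δ) (by simp; linarith)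
    have hc2 : Tendsto (fun τ : ℝ => K * τ) (𝓝[>] 0) (𝓝 (K * 0)) := by
      apply tendsto_nhdsWithin_of_tendsto_nhds
      exact (Continuous.tendsto (by fun_prop) 0)
    have h2 := hc2.eventually_lt_const (u := 1 / 2) (by simp)
    obtain ⟨τ, ⟨h1, h2⟩, h3⟩ := ((h1.and h2).and self_mem_nhdsWithin).exists
    exact ⟨τ, h3, h2.le, h1⟩
  have hgrow : ∀ j ≥ n0, ∀ m ≥ j, s m - s j ≤ τ →
      g m + D ≤ (g j + D) * Real.exp (2 * K * (s m - s j)) := by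
    intro j hj m hm
    induction m, hm using Nat.le_induction with
    | base => simp
    | succ m hm ih =>
      intro hτm
      rw [hs1] at hτm ⊢
      have hp := hlam m
      have hsm := hmono hm
      have ih := ih (by linarith)
      have h1 := hstep m (hj.trans hm) (le_trans (by gcongr; linarith) hτK)
      have h2 : 0 ≤ g m + D := by linarith [hg m (hj.trans hm)]
      have h3 : (g m + D) * (1 + 2 * K * lam m) ≤ (g m + D) * Real.exp (2 * K * lam m) := by
        gcongr
        linarith [Real.add_one_le_exp (2 * K * lam m)]
      have h4 : Real.exp (2 * K * (s m + lam m - s j)) =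
          Real.exp (2 * K * (s m - s j)) * Real.exp (2 * K * lam m) := by
        rw [← Real.exp_add]; ring_nf
      rw [h4, ← mul_assoc]
      have h5 := mul_le_mul_of_nonneg_right ih (Real.exp_pos (2 * K * lam m)).le
      nlinarith
  have hlow : ∀ j ≥ n0, ∀ m ≥ j, s m - s j ≤ τ → δ < g m → δ / 2 ≤ g j := by
    intro j hj m hm hτm hgm
    have h1 := hgrow j hj m hm hτm
    by_contra hcon
    push Not at hcon
    have h2 : (g j + D) * Real.exp (2 * K * (s m - s j)) ≤ (D + δ / 2) * Real.exp (2 * K * τ) := by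
      apply mul_le_mul (by linarith) _ (Real.exp_pos _).le (by linarith)
      apply Real.exp_le_exp.2
      gcongr
    linarith
  have htail : ∃ N, ∀ j ≥ N, ∀ m ≥ j, ∑ k ∈ Finset.Ico j m, |lam k * g (k + 1)| < δ / 2 * τ := by
    have hcs := hsum.hasSum.tendsto_sum_nat.cauchySeq
    rw [Metric.cauchySeq_iff] at hcs
    obtain ⟨N, hN⟩ := hcs (δ / 2 * τ) (by positivity)
    refine ⟨N, fun j hj m hm => ?_⟩
    have := hN m (hj.trans hm) j hj
    rw [Real.dist_eq, ← Finset.sum_Ico_eq_sub _ hm] at this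
    exact (le_abs_self _).trans_lt this
  obtain ⟨N, hN⟩ := htail
  set N' := max N n0
  have hev := hdiv.eventually_ge_atTop (s N' + τ)
  filter_upwards [hev, eventually_ge_atTop N'] with m hm hmN
  by_contra hcon
  push Not at hcon
  classical
  set P : ℕ → Prop := fun j => τ ≤ s m - s j
  have hPN : P N' := by change τ ≤ s m - s N'; change s N' + τ ≤ s m at hm; linarith
  set j := Nat.findGreatest P m
  have hjP : P j := Nat.findGreatest_spec hmN hPN
  have hjN : N' ≤ j := Nat.le_findGreatest hmN hPN
  have hjm : j ≤ m := Nat.findGreatest_le m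
  have hall : ∀ k ∈ Finset.Ico j m, lam k * (δ / 2) ≤ |lam k * g (k + 1)| := by
    intro k hk
    rw [Finset.mem_Ico] at hk
    have hnP : ¬ P (k + 1) := Nat.findGreatest_is_greatest (n := m) (by omega) (by omega)
    have := hlow (k + 1) (by have := le_max_right N n0; omega) m (by omega) (not_le.1 hnP).le hcon
    refine le_trans ?_ (le_abs_self _)
    have := hlam k
    gcongr
  have h1 := Finset.sum_le_sum hall
  rw [← Finset.sum_mul, Finset.sum_Ico_eq_sub _ hjm] at h1
  have h2 := hN j (le_trans (le_max_left _ _) hjN) m hjm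
  have h3 : τ * (δ / 2) ≤ (s m - s j) * (δ / 2) := by gcongr
  change (s m - s j) * (δ / 2) ≤ _ at h1
  linarith

lemma aux_sub_ne_top (F : H → EReal) (hF : ProperLscConvexE F) (x p : H) (hp : p ∈ ESubdiff F x) :
    F x ≠ ⊤ := by
  intro h
  obtain ⟨y, hy⟩ := hF.1
  have := hp y
  rw [h, EReal.top_add_coe, top_le_iff] at this
  exact hy this

lemma aux_coe (F : H → EReal) (hF : ProperLscConvexE F) (x : H) (hx : F x ≠ ⊤) :
    (((F x).toReal : ℝ) : EReal) = F x := EReal.coe_toReal hx (hF.2.1 x)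

lemma aux_sub_real (F : H → EReal) (hF : ProperLscConvexE F) (x p : H) (hp : p ∈ ESubdiff F x)
    (y : H) (hy : F y ≠ ⊤) : (F x).toReal + ⟪p, y - x⟫ ≤ (F y).toReal := by
  have := hp y
  rw [← aux_coe F hF x (aux_sub_ne_top F hF x p hp), ← aux_coe F hF y hy] at this
  exact_mod_cast this

lemma aux_C (d : SFBP H) (u : H) : u ∈ d.C ↔ d.Ψ₁ u = 0 ∧ d.Ψ₂ u = 0 := by
  rw [d.Cdef]
  constructor
  · rintro ⟨h1, h2⟩
    obtain ⟨p, hp⟩ := d.minΨ₁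
    obtain ⟨q, hq⟩ := d.minΨ₂
    have h1 := h1 p
    have h2 := h2 q
    rw [hp] at h1
    rw [hq] at h2
    exact ⟨le_antisymm h1 (d.Ψ₁nonneg u), le_antisymm h2 (d.Ψ₂nonneg u)⟩
  · rintro ⟨h1, h2⟩
    exact ⟨fun q => by rw [h1]; exact d.Ψ₁nonneg q, fun q => by rw [h2]; exact d.Ψ₂nonneg q⟩

lemma aux_key (d : SFBP H) (u z : H) (hz : z ∈ nCone d.C u) :
    ∃ e : ℕ → ℝ, (∀ n, 0 ≤ e n) ∧ Summable e ∧ ∀ n y, d.Ψ₂ y ≠ ⊤ →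
      d.lam n * d.beta n * (⟪(d.beta n)⁻¹ • z, y - u⟫ - d.Ψ₁ y - (d.Ψ₂ y).toReal) ≤ e n := by
  obtain ⟨M, hM⟩ := d.keyCond z ⟨u, hz⟩
  obtain ⟨hu1, hu2⟩ := (aux_C d u).1 hz.1
  set G : ℕ → EReal := fun n => fenchelConj (fun q => ((d.Ψ₁ q : ℝ) : EReal) + d.Ψ₂ q) ((d.beta n)⁻¹ • z)
    with hG
  have hsupp : ∀ n, suppFun d.C ((d.beta n)⁻¹ • z) = ((⟪(d.beta n)⁻¹ • z, u⟫ : ℝ) : EReal) := by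
    intro n
    apply le_antisymm
    · refine iSup_le fun c => ?_
      have h1 := hz.2 c c.2
      have h2 : (d.beta n)⁻¹ * ⟪z, (c : H) - u⟫ ≤ 0 :=
        mul_nonpos_of_nonneg_of_nonpos (inv_nonneg.2 (d.betaPos n).le) h1
      rw [← real_inner_smul_left, inner_sub_right] at h2
      exact_mod_cast (by linarith : ⟪(d.beta n)⁻¹ • z, (c : H)⟫ ≤ ⟪(d.beta n)⁻¹ • z, u⟫)
    · exact le_iSup (fun c : d.C => ((⟪(d.beta n)⁻¹ • z, (c : H)⟫ : ℝ) : EReal)) ⟨u, hz.1⟩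
  have hGy : ∀ n y, d.Ψ₂ y ≠ ⊤ →
      ((⟪(d.beta n)⁻¹ • z, y⟫ - d.Ψ₁ y - (d.Ψ₂ y).toReal : ℝ) : EReal) ≤ G n := by
    intro n y hy
    have := le_iSup (fun y => (((⟪y, (d.beta n)⁻¹ • z⟫ : ℝ) : EReal) - (((d.Ψ₁ y : ℝ) : EReal) + d.Ψ₂ y))) y
    refine le_trans ?_ this
    rw [← aux_coe d.Ψ₂ d.properΨ₂ y hy, real_inner_comm, EReal.toReal_coe]
    rw [← EReal.coe_add, ← EReal.coe_sub]
    exact_mod_cast (by linarith)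
  set T : ℕ → EReal := fun n => (((d.lam n * d.beta n : ℝ)) : EReal) *
        (G n - suppFun d.C ((d.beta n)⁻¹ • z)) with hT
  have hl : ∀ n, 0 < d.lam n * d.beta n := fun n => mul_pos (d.lamPos n) (d.betaPos n)
  have hTy : ∀ n y, d.Ψ₂ y ≠ ⊤ →
      ((d.lam n * d.beta n * (⟪(d.beta n)⁻¹ • z, y - u⟫ - d.Ψ₁ y - (d.Ψ₂ y).toReal) : ℝ) : EReal)
        ≤ T n := by
    intro n y hy
    rw [EReal.coe_mul]
    apply mul_le_mul_of_nonneg_left _ (EReal.coe_nonneg.2 (hl n).le)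
    rw [hsupp]
    have := EReal.sub_le_sub (hGy n y hy) (le_refl ((⟪(d.beta n)⁻¹ • z, u⟫ : ℝ) : EReal))
    refine le_trans (le_of_eq ?_) this
    rw [← EReal.coe_sub, inner_sub_right]
    congr 1
    ring
  have hT0 : ∀ n, 0 ≤ T n := by
    intro n
    have := hTy n u (by rw [hu2]; simp)
    simpa [hu1, hu2] using this
  have hTtop : ∀ n, T n ≠ ⊤ := by
    intro n h
    have h1 : T n ≤ ∑ k ∈ Finset.range (n + 1), T k :=
      Finset.single_le_sum (fun k _ => hT0 k) (Finset.self_mem_range_succ n)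
    have h2 := h1.trans (hM (n + 1))
    rw [h, top_le_iff] at h2
    exact EReal.coe_ne_top _ h2
  have hTbot : ∀ n, T n ≠ ⊥ := fun n h => by
    have := hT0 n
    rw [h] at this
    simp at this
  have hTc : ∀ n, (((T n).toReal : ℝ) : EReal) = T n := fun n => EReal.coe_toReal (hTtop n) (hTbot n)
  refine ⟨fun n => (T n).toReal, fun n => EReal.toReal_nonneg (hT0 n), ?_, ?_⟩
  · refine summable_of_sum_range_le (c := M) (fun n => EReal.toReal_nonneg (hT0 n)) fun N => ?_
    have h : ((∑ k ∈ Finset.range N, (T k).toReal : ℝ) : EReal) = ∑ k ∈ Finset.range N, T k := by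
      induction N with
      | zero => simp
      | succ N ih => rw [Finset.sum_range_succ, Finset.sum_range_succ, EReal.coe_add, ih, hTc]
    have h2 := hM N
    change ∑ k ∈ Finset.range N, T k ≤ _ at h2
    rw [← h] at h2
    exact_mod_cast h2
  · intro n y hy
    have := hTy n y hy
    rw [← hTc n] at this
    exact_mod_cast this

/-- weak limits along ultrafilters -/
lemma aux_weaklim (x : ℕ → H) (R : ℝ) (hR : ∀ n, ‖x n‖ ≤ R) (U : Ultrafilter ℕ) :
    ∃ p : H, ∀ y, Tendsto (fun n => ⟪x n, y⟫) U (𝓝 ⟪p, y⟫) := by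
  have h1 : ∀ y : H, ∃ l : ℝ, |l| ≤ R * ‖y‖ ∧ Tendsto (fun n => ⟪x n, y⟫) U (𝓝 l) := by
    intro y
    have hb : ∀ n, |⟪x n, y⟫| ≤ R * ‖y‖ := fun n =>
      (abs_real_inner_le_norm _ _).trans (mul_le_mul_of_nonneg_right (hR n) (norm_nonneg _))
    have hc : IsCompact (Set.Icc (-(R * ‖y‖)) (R * ‖y‖)) := isCompact_Icc
    obtain ⟨l, hl, hUl⟩ := hc.ultrafilter_le_nhds (U.map fun n => ⟪x n, y⟫) (by
      rw [le_principal_iff, Ultrafilter.mem_coe, Ultrafilter.mem_map]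
      exact Filter.univ_mem' fun n => abs_le.1 (hb n))
    exact ⟨l, abs_le.2 hl, hUl⟩
  choose l hlb hl using h1
  let f : H →ₗ[ℝ] ℝ :=
    { toFun := l
      map_add' := fun a b => by
        refine tendsto_nhds_unique (hl (a + b)) ?_
        simpa only [inner_add_right] using (hl a).add (hl b)
      map_smul' := fun c a => by
        refine tendsto_nhds_unique (hl (c • a)) ?_
        simpa only [real_inner_smul_right, RingHom.id_apply, smul_eq_mul] using (hl a).const_mul c }
  let F : H →L[ℝ] ℝ := f.mkContinuous R fun y => hlb y
  refine ⟨(InnerProductSpace.toDual ℝ H).symm F, fun y => ?_⟩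
  rw [InnerProductSpace.toDual_symm_apply]
  exact hl y

lemma aux_lsc (F : H → EReal) (hF : ProperLscConvexE F) (x : ℕ → H) (U : Ultrafilter ℕ) (p : H)
    (hp : ∀ y, Tendsto (fun n => ⟪x n, y⟫) U (𝓝 ⟪p, y⟫)) (M : ℝ)
    (hM : ∀ᶠ n in (U : Filter ℕ), F (x n) ≤ (M : EReal)) : F p ≤ (M : EReal) := by
  by_contra hcon
  have hclosed : IsClosed {q | F q ≤ (M : EReal)} := hF.2.2.1.isClosed_preimage _
  have hconv : Convex ℝ {q | F q ≤ (M : EReal)} := by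
    intro a ha b hb s t hs ht hst
    have ht' : t = 1 - s := by linarith
    subst ht'
    have h := hF.2.2.2 a b s hs (by linarith)
    refine h.trans ?_
    have h1 := mul_le_mul_of_nonneg_left (show F a ≤ M from ha) (EReal.coe_nonneg.2 hs)
    have h2 := mul_le_mul_of_nonneg_left (show F b ≤ M from hb) (EReal.coe_nonneg.2 ht)
    refine (add_le_add h1 h2).trans (le_of_eq ?_)
    rw [← EReal.coe_mul, ← EReal.coe_mul, ← EReal.coe_add]
    congr 1
    ring
  obtain ⟨f, u, hfu, hfb⟩ := geometric_hahn_banach_point_closed hconv hclosed hcon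
  have h := hp ((InnerProductSpace.toDual ℝ H).symm f)
  have e : ∀ q : H, ⟪q, (InnerProductSpace.toDual ℝ H).symm f⟫ = f q := fun q => by
    rw [real_inner_comm, InnerProductSpace.toDual_symm_apply]
  simp only [e] at h
  have h2 := h.eventually_lt_const hfu
  obtain ⟨n, hn1, hn2⟩ := (hM.and h2).exists
  exact lt_asymm (hfb _ hn1) hn2

/-- minimizers belong to `S` -/
lemma aux_argmin (d : SFBP H) (Φ₂ : H → EReal) (hΦ₂ : ProperLscConvexE Φ₂)
    (hA : d.A = ESubdiff Φ₂) (p : H) (hpC : p ∈ d.C) (hpt : Φ₂ p ≠ ⊤)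
    (hmin : ∀ q ∈ d.C, Φ₂ q ≠ ⊤ → d.Φ p + (Φ₂ p).toReal ≤ d.Φ q + (Φ₂ q).toReal) : p ∈ d.S := by
  classical
  obtain ⟨hmon, hmax⟩ := d.maxmonT
  set T : H → Set H := fun p => {w | ∃ za ∈ d.A p, ∃ v ∈ nCone d.C p, w = za + d.Φ' p + v} with hT
  have key : ∀ q w, w ∈ T q → 0 ≤ ⟪w, q - p⟫ := by
    rintro q w ⟨za, hza, v, hv, rfl⟩
    rw [hA] at hza
    have h1 := aux_sub_real Φ₂ hΦ₂ q za hza p hpt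
    have h2 := aux_grad_ineq d.Φ d.Φ' d.convΦ d.gradΦ q p
    have h3 := hv.2 p hpC
    have h4 := hmin q hv.1 (aux_sub_ne_top Φ₂ hΦ₂ q za hza)
    rw [← neg_sub p q, inner_neg_right, inner_add_left, inner_add_left]
    linarith
  set B : H → Set H := fun q => {w | w ∈ T q ∨ (q = p ∧ w = 0)} with hB
  have hBmon : MonotoneOp B := by
    rintro a b a' b' (ha | ⟨rfl, rfl⟩) (hb | ⟨rfl, rfl⟩)
    · exact hmon a b a' b' ha hb
    · simpa using key a a' ha
    · have := key b b' hb
      rw [← neg_sub, ← neg_sub b a, inner_neg_neg]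
      simpa using this
    · simp
  have hBT := hmax B hBmon fun q w hw => Or.inl hw
  have h0 : (0 : H) ∈ B p := Or.inr ⟨rfl, rfl⟩
  rw [hBT] at h0
  obtain ⟨za, hza, v, hv, h⟩ := h0
  exact ⟨za, hza, v, hv, h.symm⟩

lemma aux_const (d : SFBP H) : ∃ L L₁ c : ℝ, 0 ≤ L ∧ 0 ≤ L₁ ∧ 0 < c ∧ c ≤ 1 / 2 ∧
    (∀ p q, ‖d.Φ' p - d.Φ' q‖ ≤ L * ‖p - q‖) ∧ (∀ p q, ‖d.Ψ₁' p - d.Ψ₁' q‖ ≤ L₁ * ‖p - q‖) ∧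
    ∀ᶠ n in atTop, L₁ * (d.lam n * d.beta n) ≤ 2 - 4 * c ∧ L * d.lam n ≤ c / 2 := by
  obtain ⟨γ, hγ, hev⟩ := d.limsupCond
  set γ' := max γ 0 with hγ'
  have hγ2 : γ' < 2 := max_lt hγ two_pos
  have hγ0 : 0 ≤ γ' := le_max_right _ _
  refine ⟨max d.LΦ 0, max d.LΨ₁ 0, (2 - γ') / 4, le_max_right _ _, le_max_right _ _, by linarith,
    by linarith, fun p q => (d.lipΦ p q).trans ?_, fun p q => (d.lipΨ₁ p q).trans ?_, ?_⟩
  · gcongr; exact le_max_left _ _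
  · gcongr; exact le_max_left _ _
  have hs : Summable fun n => max d.LΦ 0 * d.lam n ^ 2 := by
    rcases le_total 0 d.LΦ with h | h
    · rw [max_eq_left h]; exact d.sumSq
    · rw [max_eq_right h]; simp
  have ht := (hs.tendsto_atTop_zero.const_mul (max d.LΦ 0))
  rw [mul_zero] at ht
  have hc : 0 < ((2 - γ') / 4 / 2) ^ 2 := by
    have : 0 < 2 - γ' := by linarith
    positivity
  filter_upwards [hev, ht.eventually_lt_const hc] with n h1 h2
  constructor
  · have hl : 0 < d.lam n * d.beta n := mul_pos (d.lamPos n) (d.betaPos n)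
    have : max d.LΨ₁ 0 * (d.lam n * d.beta n) ≤ γ' := by
      rw [max_mul_of_nonneg _ _ hl.le, zero_mul]
      exact max_le_max h1 le_rfl
    linarith
  · refine (abs_le_of_sq_le_sq' (a := max d.LΦ 0 * d.lam n) (b := (2 - γ') / 4 / 2) ?_ (by linarith)).2
    nlinarith

set_option maxHeartbeats 1000000 in
lemma aux_est (d : SFBP H) (Φ₂ : H → EReal) (hΦ₂ : ProperLscConvexE Φ₂) (hA : d.A = ESubdiff Φ₂) :
    ∃ c : ℝ, 0 < c ∧ ∀ᶠ n in atTop,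
      (∀ u ∈ d.C, Φ₂ u ≠ ⊤ →
        ‖d.x (n + 1) - u‖ ^ 2 + 2 * d.lam n *
          (d.Φ (d.x (n + 1)) + (Φ₂ (d.x (n + 1))).toReal - (d.Φ u + (Φ₂ u).toReal))
          + c * (d.lam n * d.beta n * (d.Ψ₁ (d.x (n + 1)) + (d.Ψ₂ (d.x (n + 1))).toReal))
          ≤ ‖d.x n - u‖ ^ 2) ∧
      (Φ₂ (d.x n) ≠ ⊤ → d.Ψ₂ (d.x n) ≠ ⊤ →
        d.Φ (d.x (n + 1)) + (Φ₂ (d.x (n + 1))).toReal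
          + d.beta n * (d.Ψ₁ (d.x (n + 1)) + (d.Ψ₂ (d.x (n + 1))).toReal) ≤
        d.Φ (d.x n) + (Φ₂ (d.x n)).toReal + d.beta n * (d.Ψ₁ (d.x n) + (d.Ψ₂ (d.x n)).toReal)) := by
  obtain ⟨L, L₁, c, hL, hL₁, hc0, hc1, lipΦ, lipΨ, hev⟩ := aux_const d
  refine ⟨c / 4, by positivity, ?_⟩
  have hcc : 2 - 4 * c ≤ 2 * (1 - c) ^ 2 := by nlinarith [sq_nonneg c]
  filter_upwards [hev] with n hn
  obtain ⟨hn1, hn2⟩ := hn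
  obtain ⟨a, ha, w, hw, hx⟩ := d.algo n
  rw [hA] at ha
  have hlam := d.lamPos n
  have hbet := d.betaPos n
  set ℓ := d.lam n * d.beta n with hℓ
  have hℓ0 : 0 < ℓ := mul_pos hlam hbet
  set y := d.x (n + 1) with hy
  set x := d.x n with hxx
  set g := d.Ψ₁' x with hg
  have dΦ := aux_descent d.Φ d.Φ' L d.gradΦ lipΦ x y
  have dΨ := aux_descent d.Ψ₁ d.Ψ₁' L₁ d.gradΨ₁ lipΨ x y
  have hvn : ‖y - x‖ ^ 2 = ‖x - y‖ ^ 2 := by rw [norm_sub_rev]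
  rw [hvn] at dΦ dΨ
  have hv2 : 0 ≤ ‖x - y‖ ^ 2 := sq_nonneg _
  have hLv : L * d.lam n * ‖x - y‖ ^ 2 ≤ c / 2 * ‖x - y‖ ^ 2 := by gcongr
  have hL1v : L₁ * ℓ * ‖x - y‖ ^ 2 ≤ (2 - 4 * c) * ‖x - y‖ ^ 2 := by gcongr
  have expand : ∀ q, ⟪x - y, q⟫ = d.lam n * ⟪d.Φ' x, q⟫ + ℓ * ⟪g, q⟫ + d.lam n * ⟪a, q⟫ + ℓ * ⟪w, q⟫ := by
    intro q
    rw [hx, real_inner_smul_left, inner_add_left, inner_add_left, inner_add_left,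
      real_inner_smul_left, real_inner_smul_left, hℓ]
    ring
  constructor
  · intro u hu hut
    obtain ⟨hu1, hu2⟩ := (aux_C d u).1 hu
    have s1 := aux_sub_real Φ₂ hΦ₂ y a ha u hut
    have s2 := aux_sub_real d.Ψ₂ d.properΨ₂ y w hw u (by rw [hu2]; simp)
    rw [hu2, EReal.toReal_zero] at s2
    have gΦ := aux_grad_ineq d.Φ d.Φ' d.convΦ d.gradΦ x u
    have gΨ := aux_grad_ineq d.Ψ₁ d.Ψ₁' d.convΨ₁ d.gradΨ₁ x u
    rw [hu1] at gΨ
    have co := aux_cocoer d.Ψ₁ d.Ψ₁' L₁ hL₁ d.convΨ₁ d.gradΨ₁ lipΨ d.Ψ₁nonneg u hu1 x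
    have hid : ‖y - u‖ ^ 2 = ‖x - u‖ ^ 2 - ‖x - y‖ ^ 2 - 2 * ⟪x - y, y - u⟫ := by
      have : x - u = (x - y) + (y - u) := by abel
      rw [this, norm_add_sq_real]; ring
    have hsplit : ∀ q : H, ⟪q, y - u⟫ = ⟪q, y - x⟫ + ⟪q, x - u⟫ := by
      intro q; rw [← inner_add_right]; congr 1; abel
    have hneg : ∀ q a b : H, ⟪q, a - b⟫ = - ⟪q, b - a⟫ := by
      intro q a b; rw [← inner_neg_right]; congr 1; abel
    rw [hneg _ u y] at s1 s2
    rw [hneg _ u x] at gΦ gΨ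
    set P := ⟪g, x - u⟫ with hP
    set Q := ⟪g, y - x⟫ with hQ
    have hP0 : 0 ≤ P := by linarith [d.Ψ₁nonneg x]
    have hlg : ℓ ^ 2 * ‖g‖ ^ 2 ≤ (2 - 4 * c) * (ℓ * P) := by
      have h1 : ℓ ^ 2 * ‖g‖ ^ 2 ≤ ℓ ^ 2 * (L₁ * P) := by gcongr
      have h2 : (L₁ * ℓ) * (ℓ * P) ≤ (2 - 4 * c) * (ℓ * P) := by gcongr
      linarith
    have hcs : ∀ r : ℝ, 0 ≤ r ^ 2 * ‖x - y‖ ^ 2 + 2 * r * (ℓ * Q) + ℓ ^ 2 * ‖g‖ ^ 2 := by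
      intro r
      have h := sq_nonneg ‖r • (y - x) + ℓ • g‖
      rw [norm_add_sq_real, norm_smul, norm_smul, mul_pow, mul_pow, hvn, real_inner_smul_left,
        real_inner_smul_right, real_inner_comm, Real.norm_eq_abs, Real.norm_eq_abs, sq_abs, sq_abs] at h
      linarith
    have hcs' : ∀ r : ℝ, 0 ≤ r ^ 2 * ‖x - y‖ ^ 2 - 2 * r * (ℓ * Q) + ℓ ^ 2 * ‖g‖ ^ 2 := by
      intro r
      have := hcs (-r)
      linarith
    have hℓP : 0 ≤ ℓ * P := by positivity
    have hcP : 0 ≤ c * (ℓ * P) := by positivity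
    have hcv : 0 ≤ c * ‖x - y‖ ^ 2 := by positivity
    have hA1 : -2 * (ℓ * Q) ≤ (1 - c) * ‖x - y‖ ^ 2 + 2 * (1 - c) * (ℓ * P) := by
      have h1 := hcs (1 - c)
      have h2 : (2 - 4 * c) * (ℓ * P) ≤ 2 * (1 - c) ^ 2 * (ℓ * P) := by
        gcongr
      have h3 : 0 ≤ (1 - c) * ((1 - c) * ‖x - y‖ ^ 2 + 2 * (1 - c) * (ℓ * P) + 2 * (ℓ * Q)) := by
        linarith
      have h4 := nonneg_of_mul_nonneg_right h3 (by linarith : 0 < 1 - c)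
      linarith
    have hB1 : ℓ * d.Ψ₁ y ≤ 2 * (ℓ * P) + 3 / 2 * ‖x - y‖ ^ 2 := by
      have h1 := mul_le_mul_of_nonneg_left dΨ hℓ0.le
      have h2 := hcs' 1
      have h3 : ℓ * d.Ψ₁ x ≤ ℓ * P := by gcongr; linarith
      linarith
    have t1 := mul_le_mul_of_nonneg_left s1 hlam.le
    have t2 := mul_le_mul_of_nonneg_left s2 hℓ0.le
    have t3 := mul_le_mul_of_nonneg_left gΦ hlam.le
    have t4 := mul_le_mul_of_nonneg_left dΦ hlam.le
    have hψ : 0 ≤ ℓ * (d.Ψ₂ y).toReal := mul_nonneg hℓ0.le (EReal.toReal_nonneg (d.Ψ₂nonneg y))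
    rw [hid, expand, hsplit (d.Φ' x), hsplit g, ← hP, ← hQ]
    have hB2 := mul_le_mul_of_nonneg_left hB1 hc0.le
    have hψ' : c * (ℓ * (d.Ψ₂ y).toReal) ≤ 8 * (ℓ * (d.Ψ₂ y).toReal) := by gcongr; linarith
    clear_value ℓ P Q
    linarith
  · intro hxt hxt2
    have s1 := aux_sub_real Φ₂ hΦ₂ y a ha x hxt
    have s2 := aux_sub_real d.Ψ₂ d.properΨ₂ y w hw x hxt2
    have e := expand (x - y)
    rw [real_inner_self_eq_norm_sq] at e
    have hneg : ∀ q : H, ⟪q, y - x⟫ = - ⟪q, x - y⟫ := by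
      intro q; rw [← inner_neg_right]; congr 1; abel
    rw [hneg] at dΦ dΨ
    have t1 := mul_le_mul_of_nonneg_left s1 hlam.le
    have t2 := mul_le_mul_of_nonneg_left s2 hℓ0.le
    have t3 := mul_le_mul_of_nonneg_left dΨ hℓ0.le
    have t4 := mul_le_mul_of_nonneg_left dΦ hlam.le
    refine le_of_mul_le_mul_left ?_ hlam
    have hcv : 0 ≤ c * ‖x - y‖ ^ 2 := by positivity
    simp only [mul_add, ← mul_assoc, ← hℓ] at *
    linarith

lemma aux_fejer (q r e : ℕ → ℝ) (hq : ∀ n, 0 ≤ q n) (he : ∀ n, 0 ≤ e n) (hes : Summable e)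
    (h : ∀ᶠ n in atTop, 0 ≤ r n ∧ q (n + 1) + r n ≤ q n + e n) :
    (∃ l, Tendsto q atTop (𝓝 l)) ∧ Summable r := by
  obtain ⟨N, hN⟩ := eventually_atTop.1 h
  have hes' : Summable fun k => e (k + N) := (summable_nat_add_iff N).2 hes
  have hE : ∀ n, ∑ k ∈ Finset.range n, e (k + N) ≤ ∑' k, e (k + N) := fun n =>
    hes'.sum_le_tsum _ fun k _ => he _
  constructor
  · have hanti : Antitone fun n => q (n + N) - ∑ k ∈ Finset.range n, e (k + N) := by
      refine antitone_nat_of_succ_le fun n => ?_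
      have := hN (n + N) (by omega)
      rw [Finset.sum_range_succ, show n + 1 + N = n + N + 1 by ring]
      linarith
    have hb : BddBelow (Set.range fun n => q (n + N) - ∑ k ∈ Finset.range n, e (k + N)) := by
      refine ⟨-∑' k, e (k + N), ?_⟩
      rintro _ ⟨n, rfl⟩
      have := hE n
      have := hq (n + N)
      simp only
      linarith
    have h1 := tendsto_atTop_ciInf hanti hb
    have h2 := h1.add hes'.hasSum.tendsto_sum_nat
    simp only [sub_add_cancel] at h2
    exact ⟨_, (tendsto_add_atTop_iff_nat N).1 h2⟩
  · refine (summable_nat_add_iff N).1 ?_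
    refine summable_of_sum_range_le (c := q N + ∑' k, e (k + N)) (fun n => (hN _ (by omega)).1) fun n => ?_
    have : q (n + N) + ∑ k ∈ Finset.range n, r (k + N) ≤ q N + ∑ k ∈ Finset.range n, e (k + N) := by
      induction n with
      | zero => simp
      | succ n ih =>
        have := hN (n + N) (by omega)
        rw [Finset.sum_range_succ, Finset.sum_range_succ, show n + 1 + N = n + N + 1 by ring]
        linarith
    have := hE n
    have := hq (n + N)
    linarith

lemma aux_fin (d : SFBP H) (Φ₂ : H → EReal) (hΦ₂ : ProperLscConvexE Φ₂) (hA : d.A = ESubdiff Φ₂)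
    (n : ℕ) : Φ₂ (d.x (n + 1)) ≠ ⊤ ∧ d.Ψ₂ (d.x (n + 1)) ≠ ⊤ := by
  obtain ⟨a, ha, w, hw, hx⟩ := d.algo n
  rw [hA] at ha
  exact ⟨aux_sub_ne_top _ hΦ₂ _ _ ha, aux_sub_ne_top _ d.properΨ₂ _ _ hw⟩

lemma aux_S (d : SFBP H) (Φ₂ : H → EReal) (hΦ₂ : ProperLscConvexE Φ₂) (hA : d.A = ESubdiff Φ₂)
    (u : H) (hu : u ∈ d.S) : u ∈ d.C ∧ Φ₂ u ≠ ⊤ ∧ ∃ v ∈ nCone d.C u, ∀ y, Φ₂ y ≠ ⊤ →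
      -⟪v, y - u⟫ ≤ d.Φ y + (Φ₂ y).toReal - (d.Φ u + (Φ₂ u).toReal) := by
  obtain ⟨za, hza, v, hv, h⟩ := hu
  rw [hA] at hza
  refine ⟨hv.1, aux_sub_ne_top _ hΦ₂ _ _ hza, v, hv, fun y hy => ?_⟩
  have h1 := aux_sub_real Φ₂ hΦ₂ u za hza y hy
  have h2 := aux_grad_ineq d.Φ d.Φ' d.convΦ d.gradΦ u y
  have h3 : ⟪za, y - u⟫ + ⟪d.Φ' u, y - u⟫ + ⟪v, y - u⟫ = 0 := by
    rw [← inner_add_left, ← inner_add_left, h, inner_zero_left]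
  linarith

lemma aux_sums (d : SFBP H) (Φ₂ : H → EReal) (hΦ₂ : ProperLscConvexE Φ₂) (hA : d.A = ESubdiff Φ₂)
    (u : H) (hu : u ∈ d.S) :
    (∃ l, Tendsto (fun n => ‖d.x n - u‖ ^ 2) atTop (𝓝 l)) ∧
    Summable (fun n => d.lam n * (d.Φ (d.x (n + 1)) + (Φ₂ (d.x (n + 1))).toReal
      - (d.Φ u + (Φ₂ u).toReal))) ∧
    Summable (fun n => d.lam n * d.beta n *
      (d.Ψ₁ (d.x (n + 1)) + (d.Ψ₂ (d.x (n + 1))).toReal)) := by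
  obtain ⟨huC, hut, v, hv, hsub⟩ := aux_S d Φ₂ hΦ₂ hA u hu
  obtain ⟨c, hc, hest⟩ := aux_est d Φ₂ hΦ₂ hA
  have hz : (4 / c) • v ∈ nCone d.C u := by
    refine ⟨hv.1, fun y hy => ?_⟩
    rw [real_inner_smul_left]
    exact mul_nonpos_of_nonneg_of_nonpos (by positivity) (hv.2 y hy)
  obtain ⟨e, he0, hes, he⟩ := aux_key d u _ hz
  set f : ℕ → ℝ := fun n => d.lam n * (d.Φ (d.x (n + 1)) + (Φ₂ (d.x (n + 1))).toReal
      - (d.Φ u + (Φ₂ u).toReal)) with hf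
  set ψ : ℕ → ℝ := fun n => d.lam n * d.beta n *
      (d.Ψ₁ (d.x (n + 1)) + (d.Ψ₂ (d.x (n + 1))).toReal) with hψ
  have hψ0 : ∀ n, 0 ≤ ψ n := fun n => mul_nonneg (mul_pos (d.lamPos n) (d.betaPos n)).le
    (add_nonneg (d.Ψ₁nonneg _) (EReal.toReal_nonneg (d.Ψ₂nonneg _)))
  have hlow : ∀ n, 0 ≤ 2 * f n + c / 2 * ψ n + c / 2 * e n := by
    intro n
    have h1 := he n (d.x (n + 1)) (aux_fin d Φ₂ hΦ₂ hA n).2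
    have h2 := hsub (d.x (n + 1)) (aux_fin d Φ₂ hΦ₂ hA n).1
    have h3 := mul_le_mul_of_nonneg_left h2 (d.lamPos n).le
    have hb := (d.betaPos n).ne'
    rw [real_inner_smul_left, real_inner_smul_left] at h1
    have e1 : d.lam n * d.beta n * ((d.beta n)⁻¹ * (4 / c * ⟪v, d.x (n + 1) - u⟫)
        - d.Ψ₁ (d.x (n + 1)) - (d.Ψ₂ (d.x (n + 1))).toReal) =
        4 / c * (d.lam n * ⟪v, d.x (n + 1) - u⟫) - ψ n := by
      simp only [hψ]; field_simp; ring
    rw [e1] at h1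
    have h4 := mul_le_mul_of_nonneg_left h1 (by positivity : 0 ≤ c / 2)
    have e2 : c / 2 * (4 / c * (d.lam n * ⟪v, d.x (n + 1) - u⟫) - ψ n) =
        2 * (d.lam n * ⟪v, d.x (n + 1) - u⟫) - c / 2 * ψ n := by field_simp; ring
    rw [e2] at h4
    change _ ≤ f n at h3
    linarith
  have hes' : Summable fun n => c / 2 * e n := hes.mul_left _
  have hmain := aux_fejer (fun n => ‖d.x n - u‖ ^ 2)
    (fun n => (2 * f n + c / 2 * ψ n + c / 2 * e n) + c / 2 * ψ n) (fun n => c / 2 * e n)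
    (fun n => sq_nonneg _) (fun n => by have := he0 n; positivity) hes' (by
      filter_upwards [hest] with n hn
      have h1 := hn.1 u huC hut
      have h2 := hlow n
      have h3 := hψ0 n
      refine ⟨by positivity, ?_⟩
      have e1 : 2 * d.lam n * (d.Φ (d.x (n + 1)) + (Φ₂ (d.x (n + 1))).toReal
        - (d.Φ u + (Φ₂ u).toReal)) = 2 * f n := by simp only [hf]; ring
      rw [e1] at h1
      change _ + c * ψ n ≤ _ at h1
      linarith)
  refine ⟨hmain.1, ?_⟩
  have hψs : Summable ψ := by
    have : Summable fun n => c / 2 * ψ n := hmain.2.of_nonneg_of_le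
      (fun n => by have := hψ0 n; positivity) fun n => by
        have := hlow n
        linarith
    have h2 := this.mul_left (2 / c)
    refine h2.congr fun n => ?_
    field_simp
  refine ⟨?_, hψs⟩
  have := ((hmain.2.sub (hψs.mul_left c)).sub hes').mul_left (1 / 2)
  refine this.congr fun n => ?_
  ring

/-- **Theorem 2.3, case (ii).** Under (H₀) with `A = ∂Φ₂`, if `liminf λ_n β_n > 0`,
`(λ_n)` is bounded and `β_{n+1} − β_n ≤ K λ_{n+1} β_{n+1}` for some `K > 0`, then
`(x_n)` converges weakly to a point of `S` and `(Φ + Φ₂)(x_n) → min_C (Φ + Φ₂)`. -/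
theorem sfbp_weak_subdiff_betaGrowth (d : SFBP H) (Φ₂ : H → EReal)
    (hΦ₂ : ProperLscConvexE Φ₂) (hA : d.A = ESubdiff Φ₂)
    (hlb : ∃ ε > (0:ℝ), ∀ᶠ n in Filter.atTop, ε ≤ d.lam n * d.beta n)
    (hbdd : ∃ B : ℝ, ∀ n, d.lam n ≤ B)
    (K : ℝ) (hK : 0 < K)
    (hbeta : ∀ n, d.beta (n + 1) - d.beta n ≤ K * (d.lam (n + 1) * d.beta (n + 1))) :
    (∃ p ∈ d.S, WeakConv d.x p) ∧
      Filter.Tendsto (fun n => ((d.Φ (d.x n) : ℝ) : EReal) + Φ₂ (d.x n)) Filter.atTop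
        (𝓝 (⨅ q ∈ d.C, (((d.Φ q : ℝ) : EReal) + Φ₂ q))) := by
  obtain ⟨u, huS⟩ : ∃ u, u ∈ d.S := d.Sne
  obtain ⟨huC, hut, v, hv, hsub⟩ := aux_S d Φ₂ hΦ₂ hA u huS
  obtain ⟨⟨l0, hl0⟩, hsf, hsψ⟩ := aux_sums d Φ₂ hΦ₂ hA u huS
  obtain ⟨c, hc, hest⟩ := aux_est d Φ₂ hΦ₂ hA
  have hfin := aux_fin d Φ₂ hΦ₂ hA
  set m : ℝ := d.Φ u + (Φ₂ u).toReal with hm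
  set f : ℕ → ℝ := fun n => d.Φ (d.x n) + (Φ₂ (d.x n)).toReal - m with hf
  set ψ : ℕ → ℝ := fun n => d.Ψ₁ (d.x n) + (d.Ψ₂ (d.x n)).toReal with hψ
  have hψ0 : ∀ n, 0 ≤ ψ n := fun n =>
    (add_nonneg (d.Ψ₁nonneg _) (EReal.toReal_nonneg (d.Ψ₂nonneg _)))
  -- boundedness
  obtain ⟨R, hR0, hR⟩ : ∃ R : ℝ, 0 ≤ R ∧ ∀ n, ‖d.x n - u‖ ≤ R := by
    obtain ⟨b, hb⟩ := hl0.bddAbove_range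
    refine ⟨Real.sqrt b, Real.sqrt_nonneg _, fun n => Real.le_sqrt_of_sq_le (hb ⟨n, rfl⟩)⟩
  have hxb : ∀ n, ‖d.x n‖ ≤ R + ‖u‖ := fun n => by
    have := norm_add_le (d.x n - u) u
    rw [sub_add_cancel] at this
    linarith [hR n]
  -- lower bound for f
  have hfD : ∀ n, 1 ≤ n → -(‖v‖ * R) ≤ f n := by
    intro n hn
    obtain ⟨k, rfl⟩ : ∃ k, n = k + 1 := ⟨n - 1, by omega⟩
    have h1 := hsub (d.x (k + 1)) (hfin k).1
    have h2 := (real_inner_le_norm v (d.x (k + 1) - u)).trans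
      (mul_le_mul_of_nonneg_left (hR (k + 1)) (norm_nonneg v))
    change _ ≤ f (k + 1) at h1
    linarith
  -- energy
  set g : ℕ → ℝ := fun n => f n + d.beta (n - 1) * ψ n with hg
  obtain ⟨N, hN⟩ := eventually_atTop.1 hest
  have hlim : ∀ δ > 0, ∀ᶠ n in atTop, g n ≤ δ := by
    intro δ hδ
    refine aux_limsup d.lam g K (‖v‖ * R) (max N 1) hK d.lamPos d.lamDiv (by positivity) ?_ ?_ ?_ δ hδ
    · intro n hn
      have h1 := hfD n (le_trans (le_max_right _ _) hn)
      have h2 := mul_nonneg (d.betaPos (n - 1)).le (hψ0 n)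
      simp only [hg]
      linarith
    · refine Summable.abs ((hsf.add hsψ).congr fun n => ?_)
      simp only [hg, hf, hψ, Nat.add_sub_cancel]
      ring
    · intro n hn hKn
      obtain ⟨k, rfl⟩ : ∃ k, n = k + 1 := ⟨n - 1, by have := le_max_right N 1; omega⟩
      have h1 := (hN (k + 1) (le_trans (le_max_left _ _) hn)).2 (hfin k).1 (hfin k).2
      have h2 := hbeta k
      have h3 := hfD (k + 1) (by omega)
      have hb1 := d.betaPos (k + 1)
      have hb0 := d.betaPos k
      have hl1 := d.lamPos (k + 1)
      have hp := hψ0 (k + 1)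
      have h4 : d.beta (k + 1) ≤ 2 * d.beta k := by
        have : K * d.lam (k + 1) * d.beta (k + 1) ≤ 1 / 2 * d.beta (k + 1) := by gcongr
        linarith
      have h5 : d.beta (k + 1) - d.beta k ≤ 2 * K * d.lam (k + 1) * d.beta k := by
        have : K * d.lam (k + 1) * d.beta (k + 1) ≤ K * d.lam (k + 1) * (2 * d.beta k) := by gcongr
        linarith
      have h6 : (d.beta (k + 1) - d.beta k) * ψ (k + 1) ≤
          2 * K * d.lam (k + 1) * d.beta k * ψ (k + 1) := by gcongr
      have h7 : 0 ≤ 2 * K * d.lam (k + 1) * (f (k + 1) + ‖v‖ * R) :=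
        mul_nonneg (by positivity) (by linarith)
      have h8 : f (k + 1 + 1) + d.beta (k + 1) * ψ (k + 1 + 1) ≤
          f (k + 1) + d.beta (k + 1) * ψ (k + 1) := by
        simp only [hf, hψ]
        linarith
      simp only [hg, Nat.add_sub_cancel]
      linarith
  have hflim : ∀ δ > 0, ∀ᶠ n in atTop, f n ≤ δ := by
    intro δ hδ
    filter_upwards [hlim δ hδ] with n hn
    have h2 := mul_nonneg (d.betaPos (n - 1)).le (hψ0 n)
    simp only [hg] at hn
    linarith
  -- penalization goes to zero
  have hψlim : ∀ δ > 0, ∀ᶠ n in atTop, ψ n ≤ δ := by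
    intro δ hδ
    obtain ⟨ε, hε, hev⟩ := hlb
    have ht := hsψ.tendsto_atTop_zero.eventually_lt_const (mul_pos hε hδ)
    have : ∀ᶠ n in atTop, ψ (n + 1) ≤ δ := by
      filter_upwards [hev, ht] with n h1 h2
      change d.lam n * d.beta n * ψ (n + 1) < ε * δ at h2
      have h3 : ε * ψ (n + 1) ≤ d.lam n * d.beta n * ψ (n + 1) :=
        mul_le_mul_of_nonneg_right h1 (hψ0 _)
      exact (lt_of_mul_lt_mul_left (h3.trans_lt h2) hε.le).le
    obtain ⟨M, hM⟩ := eventually_atTop.1 this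
    filter_upwards [eventually_ge_atTop (M + 1)] with n hn
    have := hM (n - 1) (by omega)
    rwa [Nat.sub_add_cancel (by omega)] at this
  have hge1 : ∀ᶠ n : ℕ in atTop, Φ₂ (d.x n) ≠ ⊤ ∧ d.Ψ₂ (d.x n) ≠ ⊤ := by
    filter_upwards [eventually_ge_atTop 1] with n hn
    have := hfin (n - 1)
    rwa [Nat.sub_add_cancel hn] at this
  -- minimality of u
  have humin : ∀ q ∈ d.C, Φ₂ q ≠ ⊤ → m ≤ d.Φ q + (Φ₂ q).toReal := by
    intro q hq hqt
    have h1 := hsub q hqt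
    have h2 := hv.2 q hq
    linarith
  -- weak limits along ultrafilters
  have hweak : ∀ U : Ultrafilter ℕ, (U : Filter ℕ) ≤ atTop → ∃ p ∈ d.S,
      ∀ y, Tendsto (fun n => ⟪d.x n, y⟫) U (𝓝 ⟪p, y⟫) := by
    intro U hU
    obtain ⟨p, hp⟩ := aux_weaklim d.x _ hxb U
    refine ⟨p, ?_, hp⟩
    have hdiff : ∀ z, Tendsto (fun n => ⟪z, d.x n - p⟫) U (𝓝 0) := by
      intro z
      have := (hp z).sub_const ⟪p, z⟫
      rw [sub_self] at this
      refine this.congr fun n => ?_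
      rw [inner_sub_right, real_inner_comm z, real_inner_comm z]
    have hΨ1 : d.Ψ₁ p = 0 := by
      refine le_antisymm (le_of_forall_pos_le_add fun δ hδ => ?_) (d.Ψ₁nonneg p)
      have h1 := (hdiff (d.Ψ₁' p)).eventually_const_lt (show -(δ / 2) < 0 by linarith)
      obtain ⟨n, h1, h2⟩ := (h1.and (hU (hψlim (δ / 2) (by positivity)))).exists
      have h3 := aux_grad_ineq d.Ψ₁ d.Ψ₁' d.convΨ₁ d.gradΨ₁ p (d.x n)
      have h4 := EReal.toReal_nonneg (d.Ψ₂nonneg (d.x n))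
      simp only [hψ] at h2
      linarith
    have hΨ2 : d.Ψ₂ p = 0 := by
      refine le_antisymm ?_ (d.Ψ₂nonneg p)
      have hall : ∀ δ : ℝ, 0 < δ → d.Ψ₂ p ≤ (δ : EReal) := by
        intro δ hδ
        refine aux_lsc d.Ψ₂ d.properΨ₂ d.x U p hp δ ?_
        filter_upwards [hU (hψlim δ hδ), hU hge1] with n h1 h2
        rw [← aux_coe d.Ψ₂ d.properΨ₂ _ h2.2]
        have h3 := d.Ψ₁nonneg (d.x n)
        simp only [hψ] at h1
        exact_mod_cast (by linarith : (d.Ψ₂ (d.x n)).toReal ≤ δ)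
      have hpt : d.Ψ₂ p ≠ ⊤ := fun h => by
        have := hall 1 one_pos
        rw [h, top_le_iff] at this
        exact EReal.coe_ne_top _ this
      rw [← aux_coe d.Ψ₂ d.properΨ₂ p hpt] at hall ⊢
      have : (d.Ψ₂ p).toReal ≤ 0 := le_of_forall_pos_le_add fun δ hδ => by
        have := hall δ hδ
        rw [zero_add]
        exact_mod_cast this
      exact_mod_cast this
    have hpC : p ∈ d.C := (aux_C d p).2 ⟨hΨ1, hΨ2⟩
    have hall : ∀ δ : ℝ, 0 < δ → Φ₂ p ≤ ((m - d.Φ p + δ : ℝ) : EReal) := by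
      intro δ hδ
      refine aux_lsc Φ₂ hΦ₂ d.x U p hp _ ?_
      have h1 := (hdiff (d.Φ' p)).eventually_const_lt (show -(δ / 2) < 0 by linarith)
      filter_upwards [hU (hflim (δ / 2) (by positivity)), hU hge1, h1] with n h1 h2 h4
      rw [← aux_coe Φ₂ hΦ₂ _ h2.1]
      have h3 := aux_grad_ineq d.Φ d.Φ' d.convΦ d.gradΦ p (d.x n)
      simp only [hf] at h1
      exact_mod_cast (by linarith : (Φ₂ (d.x n)).toReal ≤ m - d.Φ p + δ)
    have hpt : Φ₂ p ≠ ⊤ := fun h => by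
      have := hall 1 one_pos
      rw [h, top_le_iff] at this
      exact EReal.coe_ne_top _ this
    have hpm : d.Φ p + (Φ₂ p).toReal ≤ m := by
      refine le_of_forall_pos_le_add fun δ hδ => ?_
      have := hall δ hδ
      rw [← aux_coe Φ₂ hΦ₂ p hpt] at this
      have : (Φ₂ p).toReal ≤ m - d.Φ p + δ := by exact_mod_cast this
      linarith
    exact aux_argmin d Φ₂ hΦ₂ hA p hpC hpt fun q hq hqt => hpm.trans (humin q hq hqt)
  have huniq : ∀ U V : Ultrafilter ℕ, (U : Filter ℕ) ≤ atTop → (V : Filter ℕ) ≤ atTop →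
      ∀ p ∈ d.S, ∀ q ∈ d.S, (∀ y, Tendsto (fun n => ⟪d.x n, y⟫) U (𝓝 ⟪p, y⟫)) →
      (∀ y, Tendsto (fun n => ⟪d.x n, y⟫) V (𝓝 ⟪q, y⟫)) → p = q := by
    intro U V hU hV p hpS q hqS hp hq
    obtain ⟨⟨lp, hlp⟩, -⟩ := aux_sums d Φ₂ hΦ₂ hA p hpS
    obtain ⟨⟨lq, hlq⟩, -⟩ := aux_sums d Φ₂ hΦ₂ hA q hqS
    have h1 : Tendsto (fun n => ⟪d.x n, p - q⟫) atTop
        (𝓝 ((lq - lp + (‖p‖ ^ 2 - ‖q‖ ^ 2)) / 2)) := by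
      refine (((hlq.sub hlp).add_const _).div_const 2).congr fun n => ?_
      rw [norm_sub_sq_real, norm_sub_sq_real, inner_sub_right]
      ring
    have h2 := tendsto_nhds_unique (hp (p - q)) (h1.mono_left hU)
    have h3 := tendsto_nhds_unique (hq (p - q)) (h1.mono_left hV)
    have h4 : ⟪p - q, p - q⟫ = 0 := by rw [inner_sub_left, h2, h3, sub_self]
    exact sub_eq_zero.1 (inner_self_eq_zero.1 h4)
  obtain ⟨p, hpS, hp⟩ := hweak (Ultrafilter.of atTop) (Ultrafilter.of_le _)
  have hpw : WeakConv d.x p := by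
    intro y
    rw [tendsto_iff_ultrafilter]
    intro V hV
    obtain ⟨q, hqS, hq⟩ := hweak V hV
    rw [huniq _ V (Ultrafilter.of_le _) hV p hpS q hqS hp hq]
    exact hq y
  refine ⟨⟨p, hpS, hpw⟩, ?_⟩
  have hpC := (aux_S d Φ₂ hΦ₂ hA p hpS).1
  have hinf : (⨅ q ∈ d.C, (((d.Φ q : ℝ) : EReal) + Φ₂ q)) = (m : EReal) := by
    apply le_antisymm
    · refine (iInf₂_le u huC).trans (le_of_eq ?_)
      rw [hm, EReal.coe_add, aux_coe Φ₂ hΦ₂ u hut]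
    · refine le_iInf₂ fun q hq => ?_
      by_cases hqt : Φ₂ q = ⊤
      · rw [hqt, EReal.coe_add_top]; exact le_top
      · rw [← aux_coe Φ₂ hΦ₂ q hqt]
        exact_mod_cast humin q hq hqt
  rw [hinf]
  have hf0 : Tendsto f atTop (𝓝 0) := by
    rw [tendsto_order]
    constructor
    · intro a ha
      have h1 : Tendsto (fun n => -⟪v, d.x n - u⟫) atTop (𝓝 (-⟪v, p - u⟫)) := by
        refine ((hpw v).sub_const ⟪u, v⟫).neg.congr' ?_ |>.trans (le_of_eq ?_)
        · exact Eventually.of_forall fun n => by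
            change -(⟪d.x n, v⟫ - ⟪u, v⟫) = -⟪v, d.x n - u⟫
            rw [inner_sub_right, real_inner_comm v, real_inner_comm v]
        · rw [inner_sub_right, real_inner_comm v, real_inner_comm v]
      have h2 := hv.2 p hpC
      filter_upwards [h1.eventually_const_lt (show a < -⟪v, p - u⟫ by linarith), hge1] with n h3 h4
      exact h3.trans_le (hsub _ h4.1)
    · intro a ha
      filter_upwards [hflim (a / 2) (by linarith)] with n hn
      linarith
  have hf1 : Tendsto (fun n => ((f n + m : ℝ) : EReal)) atTop (𝓝 (m : EReal)) := by
    have := hf0.add_const m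
    rw [zero_add] at this
    exact (continuous_coe_real_ereal.tendsto m).comp this
  refine hf1.congr' ?_
  filter_upwards [hge1] with n hn
  simp only [hf, sub_add_cancel]
  rw [EReal.coe_add, aux_coe Φ₂ hΦ₂ _ hn.1]
end

section
/- (Lemma 5.4) Let (a_n), (δ_n) and (ε_n) be nonnegative real sequences and let (ξ_n) be a real sequence bounded from below. Assume that (1 − a_n) ξ_{n+1} − ξ_n + δ_n ≤ ε_n for all sufficiently large n, and that ∑ a_n < +∞ and ∑ ε_n < +∞. Then the sequence (ξ_n) converges and ∑ δ_n < +∞. -/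
open Filter Topology
open scoped RealInnerProductSpace

variable {H : Type*} [NormedAddCommGroup H] [InnerProductSpace ℝ H] [CompleteSpace H]

theorem aux_summable_conv (u f d : ℕ → ℝ) (hu : ∀ n, 0 ≤ u n) (hd : ∀ n, 0 ≤ d n)
    (hf : ∀ n, 0 ≤ f n) (hsf : Summable f) (h : ∀ n, u (n + 1) - u n + d n ≤ f n) :
    (∃ l : ℝ, Filter.Tendsto u Filter.atTop (𝓝 l)) ∧ Summable d := by
  have hF : ∀ n, ∑ k ∈ Finset.range n, f k ≤ ∑' k, f k := fun n =>
    hsf.sum_le_tsum _ (fun i _ => hf i)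
  constructor
  · have hanti : Antitone (fun n => u n - ∑ k ∈ Finset.range n, f k) := by
      apply antitone_nat_of_succ_le
      intro n
      rw [Finset.sum_range_succ]
      linarith [h n, hd n]
    have hb : BddBelow (Set.range (fun n => u n - ∑ k ∈ Finset.range n, f k)) := by
      refine ⟨-∑' k, f k, ?_⟩
      rintro _ ⟨n, rfl⟩
      have := hF n
      have := hu n
      simp only
      linarith
    have h1 := tendsto_atTop_ciInf hanti hb
    have h2 := h1.add hsf.hasSum.tendsto_sum_nat
    refine ⟨_, h2.congr (fun n => ?_)⟩
    ring
  · refine summable_of_sum_range_le (c := u 0 + ∑' k, f k) hd (fun n => ?_)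
    have key : u n + ∑ k ∈ Finset.range n, d k ≤ u 0 + ∑ k ∈ Finset.range n, f k := by
      induction n with
      | zero => simp
      | succ n ih =>
        rw [Finset.sum_range_succ, Finset.sum_range_succ]
        linarith [h n]
    linarith [hF n, hu n]

theorem aux_bounded (u a e : ℕ → ℝ) (hu : ∀ n, 0 ≤ u n) (ha : ∀ n, 0 ≤ a n)
    (ha2 : ∀ n, a n ≤ 1 / 2) (he : ∀ n, 0 ≤ e n) (hsa : Summable a) (hse : Summable e)
    (h : ∀ n, (1 - a n) * u (n + 1) ≤ u n + e n) :
    ∃ M : ℝ, 0 ≤ M ∧ ∀ n, u n ≤ M := by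
  have hA : ∀ n, ∑ k ∈ Finset.range n, a k ≤ ∑' k, a k := fun n =>
    hsa.sum_le_tsum _ (fun i _ => ha i)
  have hE : ∀ n, ∑ k ∈ Finset.range n, e k ≤ ∑' k, e k := fun n =>
    hse.sum_le_tsum _ (fun i _ => he i)
  have key : ∀ n, u n ≤ Real.exp (2 * ∑ k ∈ Finset.range n, a k) *
      (u 0 + ∑ k ∈ Finset.range n, e k) := by
    intro n
    induction n with
    | zero => simp
    | succ n ih =>
      rw [Finset.sum_range_succ, Finset.sum_range_succ, mul_add 2, Real.exp_add]
      set X := Real.exp (2 * ∑ k ∈ Finset.range n, a k) with hX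
      set S := ∑ k ∈ Finset.range n, e k
      have hX1 : 1 ≤ X := Real.one_le_exp
        (mul_nonneg (by norm_num) (Finset.sum_nonneg (fun i _ => ha i)))
      have hexp : 1 + 2 * a n ≤ Real.exp (2 * a n) := by
        linarith [Real.add_one_le_exp (2 * a n)]
      have h1 : u (n + 1) ≤ (1 + 2 * a n) * (u n + e n) := by
        have h3 : (1 + 2 * a n) * ((1 - a n) * u (n + 1)) ≤ (1 + 2 * a n) * (u n + e n) :=
          mul_le_mul_of_nonneg_left (h n) (by linarith [ha n])
        have h4 : 0 ≤ a n * (1 - 2 * a n) * u (n + 1) :=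
          mul_nonneg (mul_nonneg (ha n) (by linarith [ha2 n])) (hu _)
        nlinarith
      have h2 : u n + e n ≤ X * (u 0 + (S + e n)) := by
        nlinarith [he n]
      calc u (n + 1) ≤ (1 + 2 * a n) * (u n + e n) := h1
        _ ≤ Real.exp (2 * a n) * (u n + e n) :=
          mul_le_mul_of_nonneg_right hexp (add_nonneg (hu n) (he n))
        _ ≤ Real.exp (2 * a n) * (X * (u 0 + (S + e n))) :=
          mul_le_mul_of_nonneg_left h2 (Real.exp_pos _).le
        _ = _ := by ring
  have hE0 : 0 ≤ ∑' k, e k := tsum_nonneg he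
  refine ⟨Real.exp (2 * ∑' k, a k) * (u 0 + ∑' k, e k),
    mul_nonneg (Real.exp_pos _).le (add_nonneg (hu 0) hE0), fun n => (key n).trans ?_⟩
  apply mul_le_mul
  · exact Real.exp_le_exp.mpr (by linarith [hA n])
  · linarith [hE n]
  · exact add_nonneg (hu 0) (Finset.sum_nonneg (fun i _ => he i))
  · exact (Real.exp_pos _).le

/-- **Lemma 5.4.** A convergence lemma for real sequences. -/
theorem real_seq_convergence_lemma (a δ ε ξ : ℕ → ℝ)
    (ha : ∀ n, 0 ≤ a n) (hδ : ∀ n, 0 ≤ δ n) (hε : ∀ n, 0 ≤ ε n)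
    (hbdd : ∃ m : ℝ, ∀ n, m ≤ ξ n)
    (hineq : ∀ᶠ n in Filter.atTop, (1 - a n) * ξ (n + 1) - ξ n + δ n ≤ ε n)
    (hsa : Summable a) (hsε : Summable ε) :
    (∃ l : ℝ, Filter.Tendsto ξ Filter.atTop (𝓝 l)) ∧ Summable δ := by
  obtain ⟨m, hm⟩ := hbdd
  have hsmall : ∀ᶠ n in Filter.atTop, a n ≤ 1 / 2 :=
    (hsa.tendsto_atTop_zero.eventually (gt_mem_nhds (by norm_num : (0:ℝ) < 1 / 2))).mono
      (fun n hn => le_of_lt hn)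
  obtain ⟨N, hN⟩ := Filter.eventually_atTop.mp (hineq.and hsmall)
  have hsa' : Summable (fun n => a (n + N)) := (summable_nat_add_iff N).mpr hsa
  have hsε' : Summable (fun n => ε (n + N)) := (summable_nat_add_iff N).mpr hsε
  have hse : Summable (fun n => ε (n + N) + a (n + N) * |m|) := hsε'.add (hsa'.mul_right _)
  have hee : ∀ n, 0 ≤ ε (n + N) + a (n + N) * |m| := fun n =>
    add_nonneg (hε _) (mul_nonneg (ha _) (abs_nonneg _))
  have hmain : ∀ n, (1 - a (n + N)) * (ξ (n + 1 + N) - m) - (ξ (n + N) - m) + δ (n + N)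
      ≤ ε (n + N) + a (n + N) * |m| := by
    intro n
    have h1 := (hN (n + N) (by omega)).1
    rw [show n + N + 1 = n + 1 + N by omega] at h1
    have h2 := mul_le_mul_of_nonneg_left (le_abs_self m) (ha (n + N))
    linarith
  obtain ⟨M, hM0, hM⟩ := aux_bounded (fun n => ξ (n + N) - m) (fun n => a (n + N))
    (fun n => ε (n + N) + a (n + N) * |m|) (fun n => by simpa using hm (n + N))
    (fun n => ha _) (fun n => (hN (n + N) (by omega)).2) hee hsa' hse
    (fun n => by linarith [hmain n, hδ (n + N)])
  obtain ⟨⟨l, hl⟩, hs⟩ := aux_summable_conv (fun n => ξ (n + N) - m)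
    (fun n => ε (n + N) + a (n + N) * |m| + a (n + N) * M) (fun n => δ (n + N))
    (fun n => by simpa using hm (n + N)) (fun n => hδ _)
    (fun n => add_nonneg (hee n) (mul_nonneg (ha _) hM0)) (hse.add (hsa'.mul_right _))
    (fun n => by
      have h1 := hmain n
      have h2 := mul_le_mul_of_nonneg_left (hM (n + 1)) (ha (n + N))
      linarith)
  refine ⟨⟨l + m, ?_⟩, (summable_nat_add_iff N).mp hs⟩
  rw [← Filter.tendsto_add_atTop_iff_nat N]
  exact (hl.add_const m).congr (fun n => by ring)
end

section
/- (Claim 5.5) Let A : H → Set H be a monotone operator, Φ, Ψ₁ : H → ℝ convex differentiable functions, and Ψ₂ : H → ℝ ∪ {+∞} a proper lower-semicontinuous convex function with min Ψ₂ = 0. Let λ_n, β_n > 0 and suppose x_n, x_{n+1} ∈ H satisfy (x_n − x_{n+1})/λ_n − ∇Φ(x_n) − v_{n+1} − β_n w_{n+1} − β_n ∇Ψ₁(x_n) = 0 for some v_{n+1} ∈ A x_{n+1} and w_{n+1} ∈ ∂Ψ₂(x_{n+1}). Then for every u with Ψ₂(u) = 0 and every z ∈ A u: ‖x_{n+1}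 − u‖² − ‖x_n − u‖² + ‖x_{n+1} − x_n‖² + 2λ_n⟨∇Φ(x_n) − ∇Φ(u), x_{n+1} − u⟩ + 2λ_nβ_n⟨∇Ψ₁(x_n), x_{n+1} − u⟩ ≤ 2λ_n⟨∇Φ(u) + z, u − x_{n+1}⟩ − 2λ_nβ_nΨ₂(x_{n+1}). -/
open Filter Topology
open scoped RealInnerProductSpace

variable {H : Type*} [NormedAddCommGroup H] [InnerProductSpace ℝ H] [CompleteSpace H]

/-- **Claim 5.5.** -/
theorem sfbp_claim_one_step (A : H → Set H) (hA : MonotoneOp A)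
    (Φ : H → ℝ) (Φ' : H → H) (hcΦ : ConvexOn ℝ Set.univ Φ)
    (hgΦ : ∀ p, HasGradientAt Φ (Φ' p) p)
    (Ψ₁ : H → ℝ) (Ψ₁' : H → H) (hcΨ₁ : ConvexOn ℝ Set.univ Ψ₁)
    (hgΨ₁ : ∀ p, HasGradientAt Ψ₁ (Ψ₁' p) p)
    (Ψ₂ : H → EReal) (hΨ₂ : ProperLscConvexE Ψ₂)
    (hΨ₂nonneg : ∀ p, (0 : EReal) ≤ Ψ₂ p)
    (lam beta : ℝ) (hlam : 0 < lam) (hbeta : 0 < beta)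
    (xn xn1 v w : H) (hv : v ∈ A xn1) (hw : w ∈ ESubdiff Ψ₂ xn1)
    (halgo : lam⁻¹ • (xn - xn1) - Φ' xn - v - beta • w - beta • Ψ₁' xn = 0)
    (u : H) (hu : Ψ₂ u = 0) (z : H) (hz : z ∈ A u) :
    ((‖xn1 - u‖ ^ 2 - ‖xn - u‖ ^ 2 + ‖xn1 - xn‖ ^ 2
        + 2 * lam * ⟪Φ' xn - Φ' u, xn1 - u⟫
        + 2 * (lam * beta) * ⟪Ψ₁' xn, xn1 - u⟫ : ℝ) : EReal)
      ≤ ((2 * lam * ⟪Φ' u + z, u - xn1⟫ : ℝ) : EReal)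
        - ((2 * (lam * beta) : ℝ) : EReal) * Ψ₂ xn1 := by
  have h1 := hA xn1 u v z hv hz
  have h2 := hw u
  rw [hu] at h2
  have h0 := hΨ₂nonneg xn1
  generalize Ψ₂ xn1 = r at h2 h0 ⊢
  induction r with
  | bot => simp at h0
  | top => simp at h2
  | coe r =>
    have h3 : r + ⟪w, u - xn1⟫ ≤ 0 := by exact_mod_cast h2
    have e : xn = xn1 + lam • (Φ' xn + v + beta • w + beta • Ψ₁' xn) := by
      have h4 : lam⁻¹ • (xn - xn1) = Φ' xn + v + beta • w + beta • Ψ₁' xn := by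
        rw [← sub_eq_zero, ← halgo]; abel
      rw [← h4, smul_inv_smul₀ hlam.ne']; abel
    have h5 : ‖xn1 - u‖ ^ 2 - ‖xn - u‖ ^ 2 + ‖xn1 - xn‖ ^ 2
        = -(2 * ⟪xn - xn1, xn1 - u⟫) := by
      have h6 : xn - u = (xn - xn1) + (xn1 - u) := by abel
      rw [h6, norm_add_sq_real, norm_sub_rev xn1 xn]; ring
    have h7 : ⟪xn - xn1, xn1 - u⟫ = lam * (⟪Φ' xn, xn1 - u⟫ + ⟪v, xn1 - u⟫
        + beta * ⟪w, xn1 - u⟫ + beta * ⟪Ψ₁' xn, xn1 - u⟫) := by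
      have h8 : xn - xn1 = lam • (Φ' xn + v + beta • w + beta • Ψ₁' xn) :=
        sub_eq_iff_eq_add'.mpr e
      rw [h8]
      simp only [inner_add_left, real_inner_smul_left]
    rw [← neg_sub xn1 u, inner_neg_right] at h3
    rw [inner_sub_left] at h1
    rw [h5, h7, ← neg_sub xn1 u, inner_neg_right, inner_add_left, inner_sub_left]
    have h9 := mul_nonneg hlam.le h1
    have h10 := mul_nonpos_of_nonneg_of_nonpos (mul_pos hlam hbeta).le h3
    rw [← EReal.coe_mul, ← EReal.coe_sub, EReal.coe_le_coe_iff]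
    nlinarith [h9, h10]
end

section
/- (Claim 5.10) Assume hypotheses (H₀). There exist constants a, b, c, d, e > 0 such that for every u ∈ C ∩ dom A and every z ∈ A u, the following holds for all sufficiently large n: (1 − aL_Φλ_n²)‖x_{n+1} − u‖² − ‖x_n − u‖² + b‖x_{n+1} − x_n‖² + cλ_n‖∇Φ(x_{n+1}) − ∇Φ(u)‖² + dλ_nβ_n(Ψ₁ + Ψ₂)(x_{n+1}) + eλ_nβ_n‖∇Ψ₁(x_n)‖² ≤ 2λ_n⟨∇Φ(u) + z, u − x_{n+1}⟩. -/
open Filter Topology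
open scoped RealInnerProductSpace

variable {H : Type*} [NormedAddCommGroup H] [InnerProductSpace ℝ H] [CompleteSpace H]

theorem sfbp_line_deriv {f : H → ℝ} {f' : H → H} (hg : ∀ p, HasGradientAt f (f' p) p)
    (x v : H) (t : ℝ) : HasDerivAt (fun t : ℝ => f (x + t • v)) ⟪f' (x + t • v), v⟫ t := by
  have h1 : HasDerivAt (fun t : ℝ => x + t • v) v t := by
    simpa using ((hasDerivAt_id t).smul_const v).const_add x
  have h2 := (hg (x + t • v)).hasFDerivAt.comp_hasDerivAt t h1
  simpa [Function.comp_def] using h2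

theorem sfbp_grad_ineq {f : H → ℝ} {f' : H → H} (hc : ConvexOn ℝ Set.univ f)
    (hg : ∀ p, HasGradientAt f (f' p) p) (x y : H) :
    f x + ⟪f' x, y - x⟫ ≤ f y := by
  have hd := sfbp_line_deriv hg x (y - x) 0
  have hcl : ConvexOn ℝ Set.univ (fun t : ℝ => f (x + t • (y - x))) := by
    have := hc.comp_affineMap (AffineMap.lineMap x y : ℝ →ᵃ[ℝ] H)
    simpa [Function.comp_def, AffineMap.lineMap_apply, add_comm] using this
  have h := hcl.le_slope_of_hasDerivAt (Set.mem_univ 0) (Set.mem_univ 1) one_pos hd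
  simp [slope_def_field] at h
  linarith

theorem sfbp_descent {f : H → ℝ} {f' : H → H} {L : ℝ}
    (hg : ∀ p, HasGradientAt f (f' p) p) (hl : ∀ p q, ‖f' p - f' q‖ ≤ L * ‖p - q‖) (x y : H) :
    f y ≤ f x + ⟪f' x, y - x⟫ + L / 2 * ‖y - x‖ ^ 2 := by
  have hd : ∀ t : ℝ, HasDerivAt
      (fun t : ℝ => f (x + t • (y - x)) - t * ⟪f' x, y - x⟫ - t ^ 2 * (L / 2 * ‖y - x‖ ^ 2))
      (⟪f' (x + t • (y - x)), y - x⟫ - ⟪f' x, y - x⟫ - (2 * t) * (L / 2 * ‖y - x‖ ^ 2)) t := by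
    intro t
    have h1 := sfbp_line_deriv hg x (y - x) t
    have h2 := (hasDerivAt_id t).mul_const ⟪f' x, y - x⟫
    have h3 := (hasDerivAt_pow 2 t).mul_const (L / 2 * ‖y - x‖ ^ 2)
    have h4 := (h1.sub h2).sub h3
    simp only [one_mul, id] at h4
    have e : (((2 : ℕ) : ℝ) * t ^ (2 - 1)) = 2 * t := by norm_num
    rw [e] at h4
    exact h4
  have hanti : AntitoneOn
      (fun t : ℝ => f (x + t • (y - x)) - t * ⟪f' x, y - x⟫ - t ^ 2 * (L / 2 * ‖y - x‖ ^ 2))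
      (Set.Icc 0 1) := by
    apply antitoneOn_of_deriv_nonpos (convex_Icc 0 1)
    · exact fun t _ => (hd t).continuousAt.continuousWithinAt
    · exact fun t _ => (hd t).differentiableAt.differentiableWithinAt
    · intro t ht
      rw [interior_Icc] at ht
      rw [(hd t).deriv, ← inner_sub_left]
      have h1 := real_inner_le_norm (f' (x + t • (y - x)) - f' x) (y - x)
      have h2 := hl (x + t • (y - x)) x
      rw [add_sub_cancel_left, norm_smul, Real.norm_of_nonneg ht.1.le] at h2
      have h3 := mul_le_mul_of_nonneg_right h2 (norm_nonneg (y - x))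
      nlinarith
  have h := hanti (Set.left_mem_Icc.2 zero_le_one) (Set.right_mem_Icc.2 zero_le_one) zero_le_one
  simp at h
  linarith

theorem sfbp_breg {f : H → ℝ} {f' : H → H} {L : ℝ} (hL : 0 < L) (hc : ConvexOn ℝ Set.univ f)
    (hg : ∀ p, HasGradientAt f (f' p) p) (hl : ∀ p q, ‖f' p - f' q‖ ≤ L * ‖p - q‖) (x y : H) :
    f x + ⟪f' x, y - x⟫ + ‖f' y - f' x‖ ^ 2 / (2 * L) ≤ f y := by
  have h1 := sfbp_grad_ineq hc hg x (y - L⁻¹ • (f' y - f' x))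
  have h2 := sfbp_descent hg hl y (y - L⁻¹ • (f' y - f' x))
  have e1 : y - L⁻¹ • (f' y - f' x) - x = (y - x) - L⁻¹ • (f' y - f' x) := by abel
  have e2 : y - L⁻¹ • (f' y - f' x) - y = - (L⁻¹ • (f' y - f' x)) := by abel
  rw [e1, inner_sub_right, inner_smul_right] at h1
  rw [e2, inner_neg_right, inner_smul_right, norm_neg, norm_smul, Real.norm_of_nonneg
    (inv_pos.2 hL).le] at h2
  have e3 : ⟪f' y, f' y - f' x⟫ - ⟪f' x, f' y - f' x⟫ = ‖f' y - f' x‖ ^ 2 := by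
    rw [← inner_sub_left, real_inner_self_eq_norm_sq]
  have e4 : L / 2 * (L⁻¹ * ‖f' y - f' x‖) ^ 2 = ‖f' y - f' x‖ ^ 2 / (2 * L) := by
    field_simp
  have e5 : L⁻¹ * ⟪f' y, f' y - f' x⟫ - L⁻¹ * ⟪f' x, f' y - f' x⟫
      = 2 * (‖f' y - f' x‖ ^ 2 / (2 * L)) := by
    rw [← mul_sub, e3]; field_simp
  linarith

theorem sfbp_coco {f : H → ℝ} {f' : H → H} {L : ℝ} (hL : 0 < L) (hc : ConvexOn ℝ Set.univ f)
    (hg : ∀ p, HasGradientAt f (f' p) p) (hl : ∀ p q, ‖f' p - f' q‖ ≤ L * ‖p - q‖) (x y : H) :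
    ‖f' y - f' x‖ ^ 2 / L ≤ ⟪f' y - f' x, y - x⟫ := by
  have h1 := sfbp_breg hL hc hg hl x y
  have h2 := sfbp_breg hL hc hg hl y x
  have e1 : ⟪f' y, x - y⟫ = - ⟪f' y, y - x⟫ := by rw [← inner_neg_right, neg_sub]
  have e2 : ‖f' y - f' x‖ ^ 2 / L = 2 * (‖f' y - f' x‖ ^ 2 / (2 * L)) := by field_simp
  rw [norm_sub_rev (f' x)] at h2
  rw [inner_sub_left, e2]
  linarith

theorem sfbp_core {p L γ g δ P X : ℝ} (hp : 0 < p) (hL : 0 < L) (hγ : p * L ≤ γ)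
    (h1 : 1 ≤ γ) (h2 : γ < 2) (hP : 0 ≤ P)
    (i1 : 2 * p * (g ^ 2 / L) - 2 * p * (g * δ) ≤ X)
    (i2 : 2 * p * P + p * (g ^ 2 / L) - p * L * δ ^ 2 ≤ X) :
    (2 - γ) / 8 * δ ^ 2 + (2 - γ) / 8 * p * P + (2 - γ) / 4 / L * p * g ^ 2 ≤ X + δ ^ 2 := by
  obtain ⟨v, rfl⟩ : ∃ v, g = L * v := ⟨g / L, by field_simp⟩
  have e1 : (L * v) ^ 2 / L = L * v ^ 2 := by field_simp
  have e2 : (2 - γ) / 4 / L * p * (L * v) ^ 2 = (2 - γ) / 4 * (p * L) * v ^ 2 := by field_simp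
  rw [e1] at i1 i2
  rw [e2]
  have hs : 0 < p * L := mul_pos hp hL
  generalize hsd : p * L = s at *
  have j1 : 2 * s * v ^ 2 - 2 * s * (v * δ) ≤ X := by rw [← hsd]; linarith
  have j2 : 2 * (p * P) + s * v ^ 2 - s * δ ^ 2 ≤ X := by
    have e3 : s * v ^ 2 = p * (L * v ^ 2) := by rw [← hsd]; ring
    linarith
  have hpP : 0 ≤ p * P := by positivity
  obtain ⟨k, hk⟩ : ∃ k, k = 1 + γ / 2 := ⟨_, rfl⟩
  have hk0 : 0 < k := by linarith
  have hd2 : 0 ≤ δ ^ 2 := sq_nonneg _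
  have hsv : 0 ≤ s * v ^ 2 := by positivity
  have y1 : 2 * s * |v * δ| ≤ k * (s * v ^ 2) + γ / k * δ ^ 2 := by
    have a1 : 2 * |v * δ| ≤ k * v ^ 2 + δ ^ 2 / k := by
      have := sq_nonneg (k * |v| - |δ|)
      rw [abs_mul, ← sq_abs v, ← sq_abs δ, ← sub_nonneg]
      have e : k * |v| ^ 2 + |δ| ^ 2 / k - 2 * (|v| * |δ|) = (k * |v| - |δ|) ^ 2 / k := by
        field_simp; ring
      rw [e]; positivity
    have a2 := mul_le_mul_of_nonneg_left a1 hs.le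
    have a3 : s * (δ ^ 2 / k) ≤ γ * (δ ^ 2 / k) :=
      mul_le_mul_of_nonneg_right hγ (by positivity)
    have a4 : γ * (δ ^ 2 / k) = γ / k * δ ^ 2 := by ring
    nlinarith
  have y2 : γ / k ≤ 1 - (2 - γ) / 4 := by
    rw [div_le_iff₀ hk0, hk]; nlinarith
  have y3 := mul_le_mul_of_nonneg_right y2 hd2
  have y13 := y1.trans (add_le_add_right y3 _)
  clear y1 y2 y3 e2
  have y4 : s * δ ^ 2 ≤ 2 * δ ^ 2 := mul_le_mul_of_nonneg_right (by linarith) hd2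
  have y5 : s * (v * δ) ≤ s * |v * δ| := mul_le_mul_of_nonneg_left (le_abs_self _) hs.le
  obtain ⟨θ, hθ⟩ : ∃ θ, θ = (2 - γ) / 16 := ⟨_, rfl⟩
  have hθ0 : 0 < θ := by linarith
  have hγθ : γ = 2 - 16 * θ := by linarith
  subst hγθ
  have z1 := mul_le_mul_of_nonneg_left j1 (show 0 ≤ 1 - θ by linarith)
  have z2 := mul_le_mul_of_nonneg_left j2 hθ0.le
  have z3 := mul_le_mul_of_nonneg_left y4 hθ0.le
  have w : 0 ≤ s * |v * δ| := by positivity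
  have z4 := mul_le_mul_of_nonneg_left y5 (show 0 ≤ 1 - θ by linarith)
  have z5 := mul_nonneg hθ0.le w
  have z6 := mul_nonneg hθ0.le hsv
  subst hk
  linarith

theorem sfbp_psi {f : H → ℝ} {f' : H → H} {L γ : ℝ} (hL : 0 ≤ L) (hc : ConvexOn ℝ Set.univ f)
    (hg : ∀ p, HasGradientAt f (f' p) p) (hl : ∀ p q, ‖f' p - f' q‖ ≤ L * ‖p - q‖)
    (h0 : ∀ p, 0 ≤ f p) (h1 : 1 ≤ γ) (h2 : γ < 2) :
    ∃ e > 0, ∀ u, f u = 0 → ∀ x y p, 0 < p → p * L ≤ γ →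
      (2 - γ) / 8 * ‖y - x‖ ^ 2 + (2 - γ) / 8 * p * f y + e * p * ‖f' x‖ ^ 2
        ≤ 2 * p * ⟪f' x, y - u⟫ + ‖y - x‖ ^ 2 := by
  have hmin : ∀ u, f u = 0 → f' u = 0 := by
    intro u hu
    have hm : IsLocalMin f u := Filter.Eventually.of_forall fun p => by rw [hu]; exact h0 p
    have := hm.hasFDerivAt_eq_zero (hg u).hasFDerivAt
    simpa using this
  rcases hL.eq_or_lt with rfl | hL
  · refine ⟨1, one_pos, fun u hu x y p hp _ => ?_⟩
    have hz : ∀ q, f' q = 0 := fun q => by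
      have := hl q u
      rw [hmin u hu] at this
      simpa using this
    have hy : f y = 0 := by
      have := sfbp_grad_ineq hc hg y u
      rw [hz, hu] at this
      simp at this
      exact le_antisymm this (h0 y)
    rw [hy, hz]
    simp
    nlinarith [sq_nonneg ‖y - x‖]
  · refine ⟨(2 - γ) / 4 / L, div_pos (by linarith) hL, fun u hu x y p hp hpL => ?_⟩
    have hu' := hmin u hu
    have b1 := sfbp_coco hL hc hg hl u x
    have b2 := sfbp_breg hL hc hg hl x u
    have b3 := sfbp_descent hg hl x y
    rw [hu', sub_zero] at b1
    rw [hu', hu, zero_sub, norm_neg] at b2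
    have e1 : ⟪f' x, y - u⟫ = ⟪f' x, y - x⟫ + ⟪f' x, x - u⟫ := by
      rw [← inner_add_right]; congr 1; abel
    have e2 : ⟪f' x, u - x⟫ = - ⟪f' x, x - u⟫ := by rw [← inner_neg_right, neg_sub]
    have b4 := (abs_le.1 (abs_real_inner_le_norm (f' x) (y - x))).1
    have e3 : ‖f' x‖ ^ 2 / (2 * L) = ‖f' x‖ ^ 2 / L / 2 := by field_simp
    rw [e3] at b2
    apply sfbp_core hp hL hpL h1 h2 (h0 y)
    · have := mul_le_mul_of_nonneg_left
        (show ‖f' x‖ ^ 2 / L - ‖f' x‖ * ‖y - x‖ ≤ ⟪f' x, y - u⟫ by linarith)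
        (show 0 ≤ 2 * p by linarith)
      linarith
    · have := mul_le_mul_of_nonneg_left
        (show f y + ‖f' x‖ ^ 2 / L / 2 - L / 2 * ‖y - x‖ ^ 2 ≤ ⟪f' x, y - u⟫ by linarith)
        (show 0 ≤ 2 * p by linarith)
      linarith

theorem sfbp_phi {f : H → ℝ} {f' : H → H} {L κ : ℝ} (hL : 0 ≤ L) (hc : ConvexOn ℝ Set.univ f)
    (hg : ∀ p, HasGradientAt f (f' p) p) (hl : ∀ p q, ‖f' p - f' q‖ ≤ L * ‖p - q‖)
    (hκ : 0 < κ) :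
    ∃ a > 0, ∃ c > 0, ∀ u x y l, 0 < l →
      c * l * ‖f' y - f' u‖ ^ 2 + 2 * l * ⟪f' u, y - u⟫ ≤
        2 * l * ⟪f' x, y - u⟫ + κ * ‖y - x‖ ^ 2 + a * L * l ^ 2 * ‖y - u‖ ^ 2 := by
  have key : ∀ u x y l, 0 < l → 2 * l * ⟪f' y - f' u, y - u⟫ + 2 * l * ⟪f' u, y - u⟫ ≤
        2 * l * ⟪f' x, y - u⟫ + κ * ‖y - x‖ ^ 2 + (L / κ + 1) * L * l ^ 2 * ‖y - u‖ ^ 2 := by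
    intro u x y l hl0
    have e1 : ⟪f' x, y - u⟫ = ⟪f' y - f' u, y - u⟫ + ⟪f' u, y - u⟫ - ⟪f' y - f' x, y - u⟫ := by
      simp only [inner_sub_left]; ring
    have b1 := real_inner_le_norm (f' y - f' x) (y - u)
    have b2 := mul_le_mul_of_nonneg_right (hl y x) (norm_nonneg (y - u))
    have b3 := mul_le_mul_of_nonneg_left (b1.trans b2) (show 0 ≤ 2 * l by linarith)
    have b4 : 2 * l * (L * ‖y - x‖ * ‖y - u‖) ≤
        κ * ‖y - x‖ ^ 2 + L / κ * L * l ^ 2 * ‖y - u‖ ^ 2 := by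
      rw [← sub_nonneg]
      have e : κ * ‖y - x‖ ^ 2 + L / κ * L * l ^ 2 * ‖y - u‖ ^ 2
          - 2 * l * (L * ‖y - x‖ * ‖y - u‖) = (κ * ‖y - x‖ - L * l * ‖y - u‖) ^ 2 / κ := by
        field_simp; ring
      rw [e]; positivity
    have b5 : 0 ≤ L * l ^ 2 * ‖y - u‖ ^ 2 := by positivity
    rw [e1]
    linarith
  refine ⟨L / κ + 1, by positivity, ?_⟩
  rcases hL.eq_or_lt with rfl | hL
  · refine ⟨1, one_pos, fun u x y l hl0 => ?_⟩
    have h := key u x y l hl0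
    have hz : f' y - f' u = 0 := by simpa using hl y u
    rw [hz] at h ⊢
    simp at h ⊢
    linarith
  · refine ⟨2 / L, by positivity, fun u x y l hl0 => ?_⟩
    have h := key u x y l hl0
    have h3 := mul_le_mul_of_nonneg_left (sfbp_coco hL hc hg hl u y)
      (show 0 ≤ 2 * l by linarith)
    have e : 2 * l * (‖f' y - f' u‖ ^ 2 / L) = 2 / L * l * ‖f' y - f' u‖ ^ 2 := by ring
    linarith

/-- **Claim 5.10.** -/
theorem sfbp_claim_combined (d : SFBP H) :
    ∃ a > (0:ℝ), ∃ b > (0:ℝ), ∃ c > (0:ℝ), ∃ d₀ > (0:ℝ), ∃ e₀ > (0:ℝ),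
      ∀ u ∈ d.C, ∀ z ∈ d.A u,
        ∀ᶠ n in Filter.atTop,
          (((1 - a * d.LΦ * d.lam n ^ 2) * ‖d.x (n + 1) - u‖ ^ 2 - ‖d.x n - u‖ ^ 2
              + b * ‖d.x (n + 1) - d.x n‖ ^ 2
              + c * d.lam n * ‖d.Φ' (d.x (n + 1)) - d.Φ' u‖ ^ 2
              + e₀ * (d.lam n * d.beta n) * ‖d.Ψ₁' (d.x n)‖ ^ 2 : ℝ) : EReal)
            + ((d₀ * (d.lam n * d.beta n) : ℝ) : EReal) *
                (((d.Ψ₁ (d.x (n + 1)) : ℝ) : EReal) + d.Ψ₂ (d.x (n + 1)))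
          ≤ ((2 * d.lam n * ⟪d.Φ' u + z, u - d.x (n + 1)⟫ : ℝ) : EReal) := by
  have hC : ∀ u ∈ d.C, d.Ψ₁ u = 0 ∧ d.Ψ₂ u = 0 := by
    intro u hu
    rw [d.Cdef] at hu
    obtain ⟨p, hp⟩ := d.minΨ₁
    obtain ⟨q, hq⟩ := d.minΨ₂
    exact ⟨le_antisymm (hp ▸ hu.1 p) (d.Ψ₁nonneg u), le_antisymm (hq ▸ hu.2 q) (d.Ψ₂nonneg u)⟩
  rcases subsingleton_or_nontrivial H with hs | hn
  · refine ⟨1, one_pos, 1, one_pos, 1, one_pos, 1, one_pos, 1, one_pos, fun u hu z hz => ?_⟩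
    refine Filter.Eventually.of_forall fun n => ?_
    rw [Subsingleton.elim (d.x (n + 1)) u, Subsingleton.elim (d.x n) u, (hC u hu).1, (hC u hu).2,
      Subsingleton.elim (d.Ψ₁' u) 0]
    simp
  obtain ⟨p, q, hpq⟩ := exists_pair_ne H
  have hpq' : 0 < ‖p - q‖ := norm_pos_iff.2 (sub_ne_zero.2 hpq)
  have hLΦ : 0 ≤ d.LΦ :=
    nonneg_of_mul_nonneg_left ((norm_nonneg _).trans (d.lipΦ p q)) hpq'
  have hLΨ : 0 ≤ d.LΨ₁ :=
    nonneg_of_mul_nonneg_left ((norm_nonneg _).trans (d.lipΨ₁ p q)) hpq'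
  obtain ⟨γ₀, hγ₀, hev⟩ := d.limsupCond
  obtain ⟨γ, hγ⟩ : ∃ γ, γ = max γ₀ 1 := ⟨_, rfl⟩
  have h1 : 1 ≤ γ := hγ ▸ le_max_right _ _
  have h2 : γ < 2 := hγ ▸ max_lt hγ₀ (by norm_num)
  obtain ⟨e, he, hψ⟩ := sfbp_psi hLΨ d.convΨ₁ d.gradΨ₁ d.lipΨ₁ d.Ψ₁nonneg h1 h2
  obtain ⟨a, ha, c, hc, hφ⟩ := sfbp_phi (κ := (2 - γ) / 16) hLΦ d.convΦ d.gradΦ d.lipΦ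
    (by linarith)
  refine ⟨a, ha, (2 - γ) / 16, by linarith, c, hc, (2 - γ) / 8, by linarith, e, he,
    fun u hu z hz => ?_⟩
  filter_upwards [hev] with n hn
  obtain ⟨hu1, hu2⟩ := hC u hu
  obtain ⟨α, hα, w, hw, heq⟩ := d.algo n
  have hw' := hw u
  rw [hu2] at hw'
  have hl := d.lamPos n
  have hb := d.betaPos n
  have hlb : 0 < d.lam n * d.beta n := mul_pos hl hb
  have hpsi := hψ u hu1 (d.x n) (d.x (n + 1)) _ hlb
    (by rw [mul_comm]; exact hn.trans (hγ ▸ le_max_left _ _))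
  have hphi := hφ u (d.x n) (d.x (n + 1)) _ hl
  have hmon := d.maxmonA.1 _ _ _ _ hα hz
  have hF0 := d.Ψ₂nonneg (d.x (n + 1))
  generalize d.Ψ₂ (d.x (n + 1)) = F at *
  induction F using EReal.rec with
  | bot => simp at hF0
  | top => rw [EReal.top_add_coe] at hw'; simp at hw'
  | coe F =>
    norm_cast at hF0
    have hw'' : F + ⟪w, u - d.x (n + 1)⟫ ≤ 0 := by exact_mod_cast hw'
    have goal : (1 - a * d.LΦ * d.lam n ^ 2) * ‖d.x (n + 1) - u‖ ^ 2 - ‖d.x n - u‖ ^ 2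
              + (2 - γ) / 16 * ‖d.x (n + 1) - d.x n‖ ^ 2
              + c * d.lam n * ‖d.Φ' (d.x (n + 1)) - d.Φ' u‖ ^ 2
              + e * (d.lam n * d.beta n) * ‖d.Ψ₁' (d.x n)‖ ^ 2
            + ((2 - γ) / 8 * (d.lam n * d.beta n)) * (d.Ψ₁ (d.x (n + 1)) + F)
          ≤ 2 * d.lam n * ⟪d.Φ' u + z, u - d.x (n + 1)⟫ := by
      generalize d.x (n + 1) = y at *
      generalize d.x n = x at *
      have e1 : ‖x - u‖ ^ 2 = ‖x - y‖ ^ 2 + 2 * ⟪x - y, y - u⟫ + ‖y - u‖ ^ 2 := by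
        rw [← norm_add_sq_real, sub_add_sub_cancel]
      have e2 : ⟪x - y, y - u⟫ = d.lam n * ⟪d.Φ' x, y - u⟫
          + d.lam n * d.beta n * ⟪d.Ψ₁' x, y - u⟫ + d.lam n * ⟪α, y - u⟫
          + d.lam n * d.beta n * ⟪w, y - u⟫ := by
        rw [heq]
        simp only [inner_smul_left, inner_add_left, RCLike.conj_to_real]
        ring
      have e3 : ⟪w, u - y⟫ = - ⟪w, y - u⟫ := by rw [← inner_neg_right, neg_sub]
      have e4 : ⟪d.Φ' u + z, u - y⟫ = - ⟪d.Φ' u, y - u⟫ - ⟪z, y - u⟫ := by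
        rw [← neg_sub y u, inner_neg_right, inner_add_left]; ring
      rw [inner_sub_left] at hmon
      have m1 := mul_le_mul_of_nonneg_left (show ⟪z, y - u⟫ ≤ ⟪α, y - u⟫ by linarith) hl.le
      have m2 := mul_le_mul_of_nonneg_left (show F ≤ ⟪w, y - u⟫ by linarith) hlb.le
      have m3 := mul_nonneg hlb.le hF0
      have m4 := mul_nonneg (show 0 ≤ 2 - (2 - γ) / 8 by linarith) m3
      rw [e1, e2, e4, norm_sub_rev x y]
      generalize d.lam n * d.beta n = p at *
      linarith
    exact_mod_cast goal
end
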